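/- Under the standing assumptions, for every n ≥ 1 the map Φ intertwines the last face of the cyclic module of A#_σH with the diagonal last face d_n∘δ_n: (d_n∘δ_n)∘Φ = Φ∘δ_n^{A#_σH} as maps (A#_σH)^{⊗(n+1)} → H^{⊗n}⊗A^{⊗n}, where δ_n^{A#_σH}(x_0⊗⋯⊗x_n) = x_nx_0⊗x_1⊗⋯⊗x_{n−1}, δ_n(g_0,…,g_n | a_0,…,a_n) = (g_0⁽²⁾,…,g_n⁽²⁾ | S(g_0⁽¹⁾⋯g_n⁽¹⁾)(a_n)a_0, a_1,…,a_{n−1}), and d_n(g_0,…,g_n | a_0,…,a_{n−1}) = (g_n^{(n+1)}g_0⁽¹⁾, g_1,…,g_{n−1} | σ(g_n^{(n+2)},g_0⁽²⁾) g_n⁽¹⁾(a_0),…, g_n^{(n)}(a_{n−1})). -/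

import Mathlib

open TensorProduct

noncomputable section

/-! ## Tensor powers, iterated comultiplication and Sweedler representations -/

/-- `Tpow k V n` is the `(n+1)`-fold tensor power `V ⊗ V ⊗ ⋯ ⊗ V` (`n+1` factors),
bundled as an object of `ModuleCat k`. -/
def Tpow (k : Type) [Field k] (V : Type) [AddCommGroup V] [Module k V] : ℕ → ModuleCat k
  | 0 => ModuleCat.of k V
  | n + 1 => ModuleCat.of k (V ⊗[k] (Tpow k V n))

/-- The elementary tensor `f 0 ⊗ f 1 ⊗ ⋯ ⊗ f n` in `Tpow k V n`. -/
def tpow (k : Type) [Field k] (V : Type) [AddCommGroup V] [Module k V] :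
    (n : ℕ) → (Fin (n + 1) → V) → Tpow k V n
  | 0, f => (f 0 : V)
  | n + 1, f => (f 0 ⊗ₜ[k] tpow k V n (fun i => f i.succ) : V ⊗[k] Tpow k V n)

/-- The iterated comultiplication `Δ⁽ⁿ⁾ : H → H^{⊗(n+1)}`, `Δ⁽⁰⁾ = id`,
`Δ⁽ⁿ⁺¹⁾ = (1 ⊗ Δ⁽ⁿ⁾) ∘ Δ`. -/
def comulIter (k : Type) [Field k] (H : Type) [Ring H] [HopfAlgebra k H] :
    (n : ℕ) → H →ₗ[k] Tpow k H n
  | 0 => LinearMap.id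
  | n + 1 =>
    (LinearMap.lTensor H (comulIter k H n) ∘ₗ Coalgebra.comul :
      H →ₗ[k] (H ⊗[k] Tpow k H n))

/-- A finite Sweedler-type representation `Δ⁽ⁿ⁾ h = ∑ᵢ h⁽¹⁾ᵢ ⊗ ⋯ ⊗ h⁽ⁿ⁺¹⁾ᵢ` of the iterated
comultiplication of `h`; `leg i j` is the `(j+1)`-st Sweedler leg of the `i`-th summand. -/
structure IterRepr (k : Type) [Field k] (H : Type) [Ring H] [HopfAlgebra k H]
    (n : ℕ) (h : H) where
  ι : Type
  s : Finset ι
  leg : ι → Fin (n + 1) → H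
  eq : ∑ i ∈ s, tpow k H n (leg i) = comulIter k H n h

/-- Merge an `(n+1)`-tuple to an `n`-tuple, replacing the two entries at positions `i, i+1`
by the single entry `v`. -/
def mergeAt {V : Type} {n : ℕ} (i : Fin n) (x : Fin (n + 1) → V) (v : V) :
    Fin n → V :=
  fun j => if (j : ℕ) < (i : ℕ) then x (Fin.castSucc j) else
    if (j : ℕ) = (i : ℕ) then v else x j.succ

variable (k : Type) [Field k] (H : Type) [Ring H] [HopfAlgebra k H]

/-- `H` is cocommutative. -/
def Cocomm : Prop :=
  ∀ h : H, (TensorProduct.comm k H H) (Coalgebra.comul (R := k) h) = Coalgebra.comul (R := k) h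

variable (A : Type) [Ring A] [Algebra k A]
variable (rho : H →ₗ[k] A →ₗ[k] A)

/-- `rho` is a weak action of `H` on `A`:
`h(ab) = h⁽¹⁾(a)h⁽²⁾(b)`, `h(1) = ε(h)1` and `1(a) = a`. -/
def IsWeakAction : Prop :=
  (∀ (h : H) (a b : A) (R : IterRepr k H 1 h),
      rho h (a * b) = ∑ i ∈ R.s, rho (R.leg i 0) a * rho (R.leg i 1) b) ∧
  (∀ h : H, rho h (1 : A) = Coalgebra.counit (R := k) h • (1 : A)) ∧
  (∀ a : A, rho 1 a = a)

/-- `rho` makes `A` a left `H`-module algebra: a weak action which is an action. -/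
def IsModuleAlgebraAction : Prop :=
  IsWeakAction k H A rho ∧ (∀ (h l : H) (a : A), rho (h * l) a = rho h (rho l a))

variable (sg : H →ₗ[k] H →ₗ[k] k)

/-- Normality for a `k`-valued cocycle: `σ(h,1) = σ(1,h) = ε(h)`. -/
def NormalK : Prop :=
  ∀ h : H, sg h 1 = Coalgebra.counit (R := k) h ∧ sg 1 h = Coalgebra.counit (R := k) h

/-- The cocycle property for a `k`-valued cocycle:
`σ(l⁽¹⁾,m⁽¹⁾)σ(h,l⁽²⁾m⁽²⁾) = σ(h⁽¹⁾,l⁽¹⁾)σ(h⁽²⁾l⁽²⁾,m)`. -/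
def CocycleK : Prop :=
  ∀ (h l m : H) (Rh : IterRepr k H 1 h) (Rl : IterRepr k H 1 l) (Rm : IterRepr k H 1 m),
    ∑ j ∈ Rl.s, ∑ c ∈ Rm.s,
        sg (Rl.leg j 0) (Rm.leg c 0) * sg h (Rl.leg j 1 * Rm.leg c 1) =
      ∑ i ∈ Rh.s, ∑ j ∈ Rl.s,
        sg (Rh.leg i 0) (Rl.leg j 0) * sg (Rh.leg i 1 * Rl.leg j 1) m

/-- The twisted module property for a `k`-valued cocycle:
`h⁽¹⁾(l⁽¹⁾(a))σ(h⁽²⁾,l⁽²⁾) = σ(h⁽¹⁾,l⁽¹⁾)(h⁽²⁾l⁽²⁾)(a)`. -/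
def TwistedModuleK : Prop :=
  ∀ (h l : H) (a : A) (Rh : IterRepr k H 1 h) (Rl : IterRepr k H 1 l),
    ∑ i ∈ Rh.s, ∑ j ∈ Rl.s,
        sg (Rh.leg i 1) (Rl.leg j 1) • rho (Rh.leg i 0) (rho (Rl.leg j 0) a) =
      ∑ i ∈ Rh.s, ∑ j ∈ Rl.s,
        sg (Rh.leg i 0) (Rl.leg j 0) • rho (Rh.leg i 1 * Rl.leg j 1) a

/-- The `k`-valued map `σ`, viewed in the convolution algebra `Hom_k(H ⊗ H, A)` via
`x ⊗ y ↦ σ(x,y)1_A`, is convolution invertible. -/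
def ConvInvertibleK : Prop :=
  ∃ sg' : H →ₗ[k] H →ₗ[k] A,
    ∀ (h l : H) (Rh : IterRepr k H 1 h) (Rl : IterRepr k H 1 l),
      (∑ i ∈ Rh.s, ∑ j ∈ Rl.s,
          (sg (Rh.leg i 0) (Rl.leg j 0) • (1 : A)) * sg' (Rh.leg i 1) (Rl.leg j 1) =
        (Coalgebra.counit (R := k) h * Coalgebra.counit (R := k) l) • (1 : A)) ∧
      (∑ i ∈ Rh.s, ∑ j ∈ Rl.s,
          sg' (Rh.leg i 0) (Rl.leg j 0) * (sg (Rh.leg i 1) (Rl.leg j 1) • (1 : A)) =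
        (Coalgebra.counit (R := k) h * Coalgebra.counit (R := k) l) • (1 : A))

/-- Normality, as an identity in `A`: `σ(h,1) = σ(1,h) = ε(h)1_A`. -/
def NormalKA : Prop :=
  ∀ h : H, sg h 1 • (1 : A) = Coalgebra.counit (R := k) h • (1 : A) ∧
    sg 1 h • (1 : A) = Coalgebra.counit (R := k) h • (1 : A)

/-- The cocycle property, as an identity in `A` (values of `σ` lie in `k·1_A`):
`σ(l⁽¹⁾,m⁽¹⁾)σ(h,l⁽²⁾m⁽²⁾) = σ(h⁽¹⁾,l⁽¹⁾)σ(h⁽²⁾l⁽²⁾,m)`. -/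
def CocycleKA : Prop :=
  ∀ (h l m : H) (Rh : IterRepr k H 1 h) (Rl : IterRepr k H 1 l) (Rm : IterRepr k H 1 m),
    ∑ j ∈ Rl.s, ∑ c ∈ Rm.s,
        (sg (Rl.leg j 0) (Rm.leg c 0) * sg h (Rl.leg j 1 * Rm.leg c 1)) • (1 : A) =
      ∑ i ∈ Rh.s, ∑ j ∈ Rl.s,
        (sg (Rh.leg i 0) (Rl.leg j 0) * sg (Rh.leg i 1 * Rl.leg j 1) m) • (1 : A)

/-! ## The operators of the cylindrical module `A ♮_σ H` -/

/-- Spec of the horizontal face `dᵢ` (`0 ≤ i < P`) on `H^{⊗(P+1)} ⊗ A^{⊗(q+1)}`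
(here `P = p+1`):
`dᵢ(g₀,…,g_P | a₀,…,a_q) = (g₀,…,gᵢ⁽¹⁾g_{i+1}⁽¹⁾,…,g_P | σ(gᵢ⁽²⁾,g_{i+1}⁽²⁾)a₀, a₁,…,a_q)`. -/
def IsHorFace (p q : ℕ) (i : Fin (p + 1))
    (D : ((Tpow k H (p + 1) : Type) ⊗[k] (Tpow k A q : Type)) →ₗ[k]
      ((Tpow k H p : Type) ⊗[k] (Tpow k A q : Type))) : Prop :=
  ∀ (g : Fin (p + 2) → H) (a : Fin (q + 1) → A)
    (R : IterRepr k H 1 (g i.castSucc)) (S : IterRepr k H 1 (g i.succ)),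
    D (tpow k H (p + 1) g ⊗ₜ[k] tpow k A q a) =
      ∑ r ∈ R.s, ∑ s ∈ S.s,
        tpow k H p (mergeAt i g (R.leg r 0 * S.leg s 0)) ⊗ₜ[k]
          tpow k A q (Function.update a 0 (sg (R.leg r 1) (S.leg s 1) • a 0))

/-- Spec of the last horizontal face `d_P` on `H^{⊗(P+1)} ⊗ A^{⊗(q+1)}` (here `P = p+1`):
`d_P(g₀,…,g_P | a₀,…,a_q) = (g_P^{(q+2)}g₀⁽¹⁾, g₁,…,g_{P−1} |
σ(g_P^{(q+3)},g₀⁽²⁾)g_P⁽¹⁾(a₀), g_P⁽²⁾(a₁),…,g_P^{(q+1)}(a_q))`. -/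
def IsLastHorFace (p q : ℕ)
    (D : ((Tpow k H (p + 1) : Type) ⊗[k] (Tpow k A q : Type)) →ₗ[k]
      ((Tpow k H p : Type) ⊗[k] (Tpow k A q : Type))) : Prop :=
  ∀ (g : Fin (p + 2) → H) (a : Fin (q + 1) → A)
    (R : IterRepr k H (q + 2) (g (Fin.last (p + 1)))) (S : IterRepr k H 1 (g 0)),
    D (tpow k H (p + 1) g ⊗ₜ[k] tpow k A q a) =
      ∑ r ∈ R.s, ∑ s ∈ S.s,
        tpow k H p
          (Fin.cases (R.leg r ⟨q + 1, by omega⟩ * S.leg s 0)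
            (fun j : Fin p => g j.succ.castSucc)) ⊗ₜ[k]
        tpow k A q (fun c : Fin (q + 1) =>
          if c = 0 then
            sg (R.leg r ⟨q + 2, by omega⟩) (S.leg s 1) • rho (R.leg r 0) (a 0)
          else rho (R.leg r (Fin.castLE (by omega) c)) (a c))

/-- Spec of the horizontal cyclic operator `t` on `H^{⊗(p+1)} ⊗ A^{⊗(q+1)}`:
`t(g₀,…,g_p | a₀,…,a_q) = (g_p^{(q+2)}, g₀,…,g_{p−1} | g_p⁽¹⁾(a₀),…,g_p^{(q+1)}(a_q))`. -/
def IsCycT (p q : ℕ)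
    (T : ((Tpow k H p : Type) ⊗[k] (Tpow k A q : Type)) →ₗ[k]
      ((Tpow k H p : Type) ⊗[k] (Tpow k A q : Type))) : Prop :=
  ∀ (g : Fin (p + 1) → H) (a : Fin (q + 1) → A)
    (R : IterRepr k H (q + 1) (g (Fin.last p))),
    T (tpow k H p g ⊗ₜ[k] tpow k A q a) =
      ∑ r ∈ R.s,
        tpow k H p (Fin.cases (R.leg r (Fin.last (q + 1))) (fun j : Fin p => g j.castSucc))
          ⊗ₜ[k]
        tpow k A q (fun c : Fin (q + 1) => rho (R.leg r c.castSucc) (a c))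

/-- Spec of the vertical cyclic operator `τ` on `H^{⊗(p+1)} ⊗ A^{⊗(q+1)}`:
`τ(g₀,…,g_p | a₀,…,a_q) = (g₀⁽²⁾,…,g_p⁽²⁾ | S(g₀⁽¹⁾⋯g_p⁽¹⁾)(a_q), a₀,…,a_{q−1})`. -/
def IsCycTau (p q : ℕ)
    (T : ((Tpow k H p : Type) ⊗[k] (Tpow k A q : Type)) →ₗ[k]
      ((Tpow k H p : Type) ⊗[k] (Tpow k A q : Type))) : Prop :=
  ∀ (g : Fin (p + 1) → H) (a : Fin (q + 1) → A)
    (R : ∀ i : Fin (p + 1), IterRepr k H 1 (g i)),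
    T (tpow k H p g ⊗ₜ[k] tpow k A q a) =
      ∑ e ∈ Fintype.piFinset (fun i => (R i).s),
        tpow k H p (fun i => (R i).leg (e i) 1) ⊗ₜ[k]
        tpow k A q
          (Fin.cases
            (rho (HopfAlgebra.antipode (R := k)
                ((List.ofFn (fun i : Fin (p + 1) => (R i).leg (e i) 0)).prod))
              (a (Fin.last q)))
            (fun c : Fin q => a c.castSucc))

/-- Spec of the vertical face `δᵢ` (`0 ≤ i < Q`) on `H^{⊗(p+1)} ⊗ A^{⊗(Q+1)}`
(here `Q = q+1`): `δᵢ(g | a₀,…,a_Q) = (g | a₀,…,aᵢa_{i+1},…,a_Q)`. -/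
def IsVerFace (p q : ℕ) (i : Fin (q + 1))
    (D : ((Tpow k H p : Type) ⊗[k] (Tpow k A (q + 1) : Type)) →ₗ[k]
      ((Tpow k H p : Type) ⊗[k] (Tpow k A q : Type))) : Prop :=
  ∀ (g : Fin (p + 1) → H) (a : Fin (q + 2) → A),
    D (tpow k H p g ⊗ₜ[k] tpow k A (q + 1) a) =
      tpow k H p g ⊗ₜ[k] tpow k A q (mergeAt i a (a i.castSucc * a i.succ))

/-- Spec of the last vertical face `δ_Q` on `H^{⊗(p+1)} ⊗ A^{⊗(Q+1)}` (here `Q = q+1`):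
`δ_Q(g₀,…,g_p | a₀,…,a_Q) = (g₀⁽²⁾,…,g_p⁽²⁾ | S(g₀⁽¹⁾⋯g_p⁽¹⁾)(a_Q)a₀, a₁,…,a_{Q−1})`. -/
def IsLastVerFace (p q : ℕ)
    (D : ((Tpow k H p : Type) ⊗[k] (Tpow k A (q + 1) : Type)) →ₗ[k]
      ((Tpow k H p : Type) ⊗[k] (Tpow k A q : Type))) : Prop :=
  ∀ (g : Fin (p + 1) → H) (a : Fin (q + 2) → A)
    (R : ∀ i : Fin (p + 1), IterRepr k H 1 (g i)),
    D (tpow k H p g ⊗ₜ[k] tpow k A (q + 1) a) =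
      ∑ e ∈ Fintype.piFinset (fun i => (R i).s),
        tpow k H p (fun i => (R i).leg (e i) 1) ⊗ₜ[k]
        tpow k A q
          (Fin.cases
            (rho (HopfAlgebra.antipode (R := k)
                ((List.ofFn (fun i : Fin (p + 1) => (R i).leg (e i) 0)).prod))
              (a (Fin.last (q + 1))) * a 0)
            (fun c : Fin q => a c.succ.castSucc))

/-! ## The crossed product `A #_σ H`, its cyclic module, and the maps `Φ`, `Ψ` -/

/-- Spec of the multiplication of the crossed product `A #_σ H` on `A ⊗ H`:
`(a ⊗ h)(b ⊗ l) = a h⁽¹⁾(b) σ(h⁽²⁾,l⁽¹⁾) ⊗ h⁽³⁾l⁽²⁾`. -/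
def IsCrossedMul (mul : (A ⊗[k] H) →ₗ[k] (A ⊗[k] H) →ₗ[k] (A ⊗[k] H)) : Prop :=
  ∀ (a b : A) (h l : H) (R : IterRepr k H 2 h) (S : IterRepr k H 1 l),
    mul (a ⊗ₜ[k] h) (b ⊗ₜ[k] l) =
      ∑ i ∈ R.s, ∑ j ∈ S.s,
        (sg (R.leg i 1) (S.leg j 0) • (a * rho (R.leg i 0) b)) ⊗ₜ[k]
          (R.leg i 2 * S.leg j 1)

/-- Spec of the map `Φ : (A #_σ H)^{⊗(n+1)} → H^{⊗(n+1)} ⊗ A^{⊗(n+1)}`: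
`Φ(a₀ ⊗ g₀,…,aₙ ⊗ gₙ) = (g₀⁽²⁾, g₁⁽³⁾,…,gₙ⁽ⁿ⁺²⁾ | S(g₀⁽¹⁾g₁⁽²⁾⋯gₙ⁽ⁿ⁺¹⁾)(a₀),…,S(gₙ⁽¹⁾)(aₙ))`. -/
def IsPhi (n : ℕ)
    (Phi : (Tpow k (A ⊗[k] H) n : Type) →ₗ[k]
      ((Tpow k H n : Type) ⊗[k] (Tpow k A n : Type))) : Prop :=
  ∀ (a : Fin (n + 1) → A) (g : Fin (n + 1) → H)
    (R : ∀ i : Fin (n + 1), IterRepr k H ((i : ℕ) + 1) (g i)),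
    Phi (tpow k (A ⊗[k] H) n (fun i => a i ⊗ₜ[k] g i)) =
      ∑ e ∈ Fintype.piFinset (fun i => (R i).s),
        tpow k H n (fun i => (R i).leg (e i) (Fin.last ((i : ℕ) + 1))) ⊗ₜ[k]
        tpow k A n (fun i =>
          rho (HopfAlgebra.antipode (R := k)
              ((List.ofFn (fun m : Fin (n + 1 - (i : ℕ)) =>
                (R ⟨(i : ℕ) + (m : ℕ), by have := m.isLt; have := i.isLt; omega⟩).leg
                  (e ⟨(i : ℕ) + (m : ℕ), by have := m.isLt; have := i.isLt; omega⟩)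
                  ⟨(m : ℕ), by have := m.isLt; have := i.isLt; simp; omega⟩)).prod))
            (a i))

/-- Spec of the map `Ψ : H^{⊗(n+1)} ⊗ A^{⊗(n+1)} → (A #_σ H)^{⊗(n+1)}`:
`Ψ(g₀,…,gₙ | a₀,…,aₙ) = ((g₀⁽¹⁾⋯gₙ⁽¹⁾)(a₀) ⊗ g₀⁽²⁾,…, gₙ⁽ⁿ⁺¹⁾(aₙ) ⊗ gₙ⁽ⁿ⁺²⁾)`. -/
def IsPsi (n : ℕ)
    (Psi : ((Tpow k H n : Type) ⊗[k] (Tpow k A n : Type)) →ₗ[k]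
      (Tpow k (A ⊗[k] H) n : Type)) : Prop :=
  ∀ (g : Fin (n + 1) → H) (a : Fin (n + 1) → A)
    (R : ∀ i : Fin (n + 1), IterRepr k H ((i : ℕ) + 1) (g i)),
    Psi (tpow k H n g ⊗ₜ[k] tpow k A n a) =
      ∑ e ∈ Fintype.piFinset (fun i => (R i).s),
        tpow k (A ⊗[k] H) n (fun i =>
          (rho ((List.ofFn (fun m : Fin (n + 1 - (i : ℕ)) =>
                (R ⟨(i : ℕ) + (m : ℕ), by have := m.isLt; have := i.isLt; omega⟩).leg
                  (e ⟨(i : ℕ) + (m : ℕ), by have := m.isLt; have := i.isLt; omega⟩)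
                  ⟨(i : ℕ), by have := m.isLt; have := i.isLt; simp; omega⟩)).prod)
            (a i)) ⊗ₜ[k]
          (R i).leg (e i) (Fin.last ((i : ℕ) + 1)))

/-- Spec of the cyclic operator of the cyclic module of an algebra, on `X^{⊗(n+1)}`:
`τ(x₀ ⊗ ⋯ ⊗ xₙ) = xₙ ⊗ x₀ ⊗ ⋯ ⊗ x_{n−1}`. -/
def IsAlgCyc (X : Type) [AddCommGroup X] [Module k X] (n : ℕ)
    (C : (Tpow k X n : Type) →ₗ[k] (Tpow k X n : Type)) : Prop :=
  ∀ x : Fin (n + 1) → X,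
    C (tpow k X n x) =
      tpow k X n (Fin.cases (x (Fin.last n)) (fun j : Fin n => x j.castSucc))

/-- Spec of the face `δᵢ` (`0 ≤ i < n+1`) of the cyclic module of the algebra
`(A ⊗ H, mul)`: `δᵢ(x₀ ⊗ ⋯ ⊗ x_{n+1}) = x₀ ⊗ ⋯ ⊗ xᵢx_{i+1} ⊗ ⋯ ⊗ x_{n+1}`. -/
def IsAlgFace (mul : (A ⊗[k] H) →ₗ[k] (A ⊗[k] H) →ₗ[k] (A ⊗[k] H)) (n : ℕ) (i : Fin (n + 1))
    (D : (Tpow k (A ⊗[k] H) (n + 1) : Type) →ₗ[k] (Tpow k (A ⊗[k] H) n : Type)) : Prop :=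
  ∀ x : Fin (n + 2) → A ⊗[k] H,
    D (tpow k (A ⊗[k] H) (n + 1) x) =
      tpow k (A ⊗[k] H) n (mergeAt i x (mul (x i.castSucc) (x i.succ)))

/-- Spec of the last face `δ_{n+1}` of the cyclic module of the algebra `(A ⊗ H, mul)`:
`δ_{n+1}(x₀ ⊗ ⋯ ⊗ x_{n+1}) = x_{n+1}x₀ ⊗ x₁ ⊗ ⋯ ⊗ xₙ`. -/
def IsAlgLastFace (mul : (A ⊗[k] H) →ₗ[k] (A ⊗[k] H) →ₗ[k] (A ⊗[k] H)) (n : ℕ)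
    (D : (Tpow k (A ⊗[k] H) (n + 1) : Type) →ₗ[k] (Tpow k (A ⊗[k] H) n : Type)) : Prop :=
  ∀ x : Fin (n + 2) → A ⊗[k] H,
    D (tpow k (A ⊗[k] H) (n + 1) x) =
      tpow k (A ⊗[k] H) n
        (Fin.cases (mul (x (Fin.last (n + 1))) (x 0)) (fun j : Fin n => x j.succ.castSucc))

section Convolution

open Coalgebra

variable {k : Type} [Field k]
variable {C : Type} [AddCommGroup C] [Module k C] [Coalgebra k C]
variable {V₁ V₂ V₃ V₄ V₅ V₆ V₇ : Type}
  [AddCommGroup V₁] [Module k V₁] [AddCommGroup V₂] [Module k V₂]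
  [AddCommGroup V₃] [Module k V₃] [AddCommGroup V₄] [Module k V₄]
  [AddCommGroup V₅] [Module k V₅] [AddCommGroup V₆] [Module k V₆]
  [AddCommGroup V₇] [Module k V₇]

/-- The convolution `c ↦ m (f c⁽¹⁾) (g c⁽²⁾)` of two linear maps along a bilinear map `m`. -/
def conv (m : V₁ →ₗ[k] V₂ →ₗ[k] V₃) (f : C →ₗ[k] V₁) (g : C →ₗ[k] V₂) : C →ₗ[k] V₃ :=
  TensorProduct.lift m ∘ₗ TensorProduct.map f g ∘ₗ comul

lemma conv_apply (m : V₁ →ₗ[k] V₂ →ₗ[k] V₃) (f : C →ₗ[k] V₁) (g : C →ₗ[k] V₂) (c : C) :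
    conv m f g c = TensorProduct.lift m (TensorProduct.map f g (comul c)) := rfl

lemma comp_conv {m : V₁ →ₗ[k] V₂ →ₗ[k] V₃} {m' : V₄ →ₗ[k] V₅ →ₗ[k] V₆}
    {φ : V₃ →ₗ[k] V₆} {u : V₁ →ₗ[k] V₄} {v : V₂ →ₗ[k] V₅}
    (h : ∀ x y, φ (m x y) = m' (u x) (v y)) (f : C →ₗ[k] V₁) (g : C →ₗ[k] V₂) :
    φ ∘ₗ conv m f g = conv m' (u ∘ₗ f) (v ∘ₗ g) := by
  ext c
  simp only [LinearMap.comp_apply, conv_apply]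
  generalize (comul c : C ⊗[k] C) = w
  induction w with
  | zero => simp
  | add x y hx hy => simp only [map_add, hx, hy]
  | tmul x y => simp [h]

lemma conv_comp {D : Type} [AddCommGroup D] [Module k D] [Coalgebra k D]
    (m : V₁ →ₗ[k] V₂ →ₗ[k] V₃) (f : C →ₗ[k] V₁) (g : C →ₗ[k] V₂) (q : D →ₗc[k] C) :
    conv m f g ∘ₗ (q : D →ₗ[k] C) = conv m (f ∘ₗ (q : D →ₗ[k] C)) (g ∘ₗ (q : D →ₗ[k] C)) := by
  ext d
  have := CoalgHomClass.map_comp_comul_apply q d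
  simp only [LinearMap.comp_apply, conv_apply, TensorProduct.map_comp]
  erw [← this]

lemma conv_congr_right (m : V₁ →ₗ[k] V₂ →ₗ[k] V₃) {m' : V₁ →ₗ[k] V₄ →ₗ[k] V₃}
    {v : V₂ →ₗ[k] V₄} (h : ∀ x y, m x y = m' x (v y)) (f : C →ₗ[k] V₁) (g : C →ₗ[k] V₂) :
    conv m f g = conv m' f (v ∘ₗ g) :=
  comp_conv (φ := LinearMap.id) (u := LinearMap.id) h f g

lemma conv_congr_left (m : V₁ →ₗ[k] V₂ →ₗ[k] V₃) {m' : V₄ →ₗ[k] V₂ →ₗ[k] V₃}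
    {u : V₁ →ₗ[k] V₄} (h : ∀ x y, m x y = m' (u x) y) (f : C →ₗ[k] V₁) (g : C →ₗ[k] V₂) :
    conv m f g = conv m' (u ∘ₗ f) g :=
  comp_conv (φ := LinearMap.id) (v := LinearMap.id) h f g

lemma conv_comp_left (m : V₄ →ₗ[k] V₂ →ₗ[k] V₃) (u : V₁ →ₗ[k] V₄) (f : C →ₗ[k] V₁)
    (g : C →ₗ[k] V₂) : conv (m ∘ₗ u) f g = conv m (u ∘ₗ f) g :=
  conv_congr_left _ (fun _ _ => rfl) f g

lemma conv_compl₁₂ (m : V₄ →ₗ[k] V₅ →ₗ[k] V₃) (u : V₁ →ₗ[k] V₄) (v : V₂ →ₗ[k] V₅)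
    (f : C →ₗ[k] V₁) (g : C →ₗ[k] V₂) :
    conv (m.compl₁₂ u v) f g = conv m (u ∘ₗ f) (v ∘ₗ g) :=
  comp_conv (φ := LinearMap.id) (fun _ _ => rfl) f g

lemma conv_flip [IsCocomm k C] (m : V₁ →ₗ[k] V₂ →ₗ[k] V₃) (f : C →ₗ[k] V₂) (g : C →ₗ[k] V₁) :
    conv m.flip f g = conv m g f := by
  ext c
  rw [conv_apply, conv_apply]
  conv_rhs => rw [← comm_comul k c]
  generalize (comul c : C ⊗[k] C) = w
  induction w with
  | zero => simp
  | add x y hx hy => simp only [map_add, hx, hy]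
  | tmul x y => simp

/-- Associativity of convolution along bilinear maps with `m₁ (m₂ x y) z = m₃ x (m₄ y z)`. -/
lemma conv_assoc {m₁ : V₄ →ₗ[k] V₃ →ₗ[k] V₅} {m₂ : V₁ →ₗ[k] V₂ →ₗ[k] V₄}
    {m₃ : V₁ →ₗ[k] V₆ →ₗ[k] V₅} {m₄ : V₂ →ₗ[k] V₃ →ₗ[k] V₆}
    (h : ∀ x y z, m₁ (m₂ x y) z = m₃ x (m₄ y z))
    (f₁ : C →ₗ[k] V₁) (f₂ : C →ₗ[k] V₂) (f₃ : C →ₗ[k] V₃) :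
    conv m₁ (conv m₂ f₁ f₂) f₃ = conv m₃ f₁ (conv m₄ f₂ f₃) := by
  let L : C ⊗[k] (C ⊗[k] C) →ₗ[k] V₅ :=
    TensorProduct.lift m₃ ∘ₗ TensorProduct.map f₁ (TensorProduct.lift m₄ ∘ₗ TensorProduct.map f₂ f₃)
  have hl : ∀ w : C ⊗[k] C, TensorProduct.lift m₁ (TensorProduct.map (conv m₂ f₁ f₂) f₃ w) =
      L (TensorProduct.assoc k C C C (comul.rTensor C w)) := by
    intro w
    induction w with
    | zero => simp
    | add x y hx hy => simp only [map_add, hx, hy]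
    | tmul x z =>
      simp only [TensorProduct.map_tmul, TensorProduct.lift.tmul, LinearMap.rTensor_tmul,
        conv_apply]
      generalize (comul x : C ⊗[k] C) = w
      induction w with
      | zero => simp
      | add x y hx hy => simp only [map_add, hx, hy, LinearMap.add_apply, TensorProduct.add_tmul]
      | tmul x y => simp [L, h]
  have hr : ∀ w : C ⊗[k] C, TensorProduct.lift m₃ (TensorProduct.map f₁ (conv m₄ f₂ f₃) w) =
      L (comul.lTensor C w) := by
    intro w
    induction w with
    | zero => simp
    | add x y hx hy => simp only [map_add, hx, hy]
    | tmul x z => simp [L, conv_apply]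
  ext c
  rw [conv_apply, conv_apply, hl, hr, coassoc_apply]

variable [IsCocomm k C]

lemma conv_comm {m : V₁ →ₗ[k] V₂ →ₗ[k] V₃} {m' : V₂ →ₗ[k] V₁ →ₗ[k] V₃}
    (h : ∀ x y, m x y = m' y x) (f : C →ₗ[k] V₁) (g : C →ₗ[k] V₂) :
    conv m f g = conv m' g f := by
  rw [← conv_flip m, LinearMap.ext₂ (f := m.flip) fun y x => h x y]

lemma conv_conv_left_comm {m₁ : V₁ →ₗ[k] V₄ →ₗ[k] V₅} {m₂ : V₂ →ₗ[k] V₃ →ₗ[k] V₄}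
    {m₃ : V₂ →ₗ[k] V₆ →ₗ[k] V₅} {m₄ : V₁ →ₗ[k] V₃ →ₗ[k] V₆}
    (h : ∀ x y z, m₁ x (m₂ y z) = m₃ y (m₄ x z))
    (f₁ : C →ₗ[k] V₁) (f₂ : C →ₗ[k] V₂) (f₃ : C →ₗ[k] V₃) :
    conv m₁ f₁ (conv m₂ f₂ f₃) = conv m₃ f₂ (conv m₄ f₁ f₃) := by
  let μ : V₁ ⊗[k] V₂ →ₗ[k] V₃ →ₗ[k] V₅ := TensorProduct.curry
    (TensorProduct.lift m₁ ∘ₗ (TensorProduct.lift m₂).lTensor V₁ ∘ₗ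
      (TensorProduct.assoc k V₁ V₂ V₃).toLinearMap)
  have hμ : ∀ x y z, μ (x ⊗ₜ y) z = m₁ x (m₂ y z) := fun x y z => by simp [μ]
  rw [← conv_assoc (m₁ := μ) (m₂ := TensorProduct.mk k V₁ V₂) hμ,
    conv_comm (m := TensorProduct.mk k V₁ V₂) (m' := (TensorProduct.mk k V₁ V₂).flip)
      (fun _ _ => rfl)]
  exact conv_assoc (fun y x z => by simp [hμ, h]) _ _ _

lemma conv_rotate {m₁ : V₄ →ₗ[k] V₃ →ₗ[k] V₅} {m₂ : V₁ →ₗ[k] V₂ →ₗ[k] V₄}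
    {m₃ : V₂ →ₗ[k] V₆ →ₗ[k] V₅} {m₄ : V₁ →ₗ[k] V₃ →ₗ[k] V₆}
    (h : ∀ x y z, m₁ (m₂ x y) z = m₃ y (m₄ x z))
    (f₁ : C →ₗ[k] V₁) (f₂ : C →ₗ[k] V₂) (f₃ : C →ₗ[k] V₃) :
    conv m₁ (conv m₂ f₁ f₂) f₃ = conv m₃ f₂ (conv m₄ f₁ f₃) := by
  rw [conv_comm (m := m₂) (m' := m₂.flip) (fun _ _ => rfl)]
  exact conv_assoc (fun y x z => h x y z) _ _ _

lemma conv_interchange {m₁ : V₅ →ₗ[k] V₆ →ₗ[k] V₃}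
    {m₂ : V₁ →ₗ[k] V₂ →ₗ[k] V₅} {m₃ : V₄ →ₗ[k] V₇ →ₗ[k] V₆}
    {U W : Type} [AddCommGroup U] [Module k U] [AddCommGroup W] [Module k W]
    {m₄ : U →ₗ[k] W →ₗ[k] V₃} {m₅ : V₁ →ₗ[k] V₄ →ₗ[k] U} {m₆ : V₂ →ₗ[k] V₇ →ₗ[k] W}
    (h : ∀ x y z w, m₁ (m₂ x y) (m₃ z w) = m₄ (m₅ x z) (m₆ y w))
    (f₁ : C →ₗ[k] V₁) (f₂ : C →ₗ[k] V₂) (f₃ : C →ₗ[k] V₄) (f₄ : C →ₗ[k] V₇) :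
    conv m₁ (conv m₂ f₁ f₂) (conv m₃ f₃ f₄) = conv m₄ (conv m₅ f₁ f₃) (conv m₆ f₂ f₄) := by
  let μ : V₁ →ₗ[k] V₂ ⊗[k] (V₄ ⊗[k] V₇) →ₗ[k] V₃ := TensorProduct.curry
    (TensorProduct.lift m₁ ∘ₗ TensorProduct.map (TensorProduct.lift m₂) (TensorProduct.lift m₃) ∘ₗ
      (TensorProduct.assoc k V₁ V₂ (V₄ ⊗[k] V₇)).symm.toLinearMap)
  have hμ : ∀ x y z, μ x (y ⊗ₜ z) = m₁ (m₂ x y) (TensorProduct.lift m₃ z) :=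
    fun x y z => by simp [μ]
  have h₃ : conv m₃ f₃ f₄ = TensorProduct.lift m₃ ∘ₗ conv (TensorProduct.mk k V₄ V₇) f₃ f₄ :=
    (comp_conv (u := LinearMap.id) (v := LinearMap.id) (fun _ _ => rfl) f₃ f₄).symm
  have h₆ : conv m₆ f₂ f₄ = TensorProduct.lift m₆ ∘ₗ conv (TensorProduct.mk k V₂ V₇) f₂ f₄ :=
    (comp_conv (u := LinearMap.id) (v := LinearMap.id) (fun _ _ => rfl) f₂ f₄).symm
  rw [h₃, ← conv_congr_right (m₁.compl₂ (TensorProduct.lift m₃)) (fun _ _ => rfl),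
    conv_assoc (m₃ := μ) (m₄ := TensorProduct.mk k V₂ (V₄ ⊗[k] V₇)) (fun x y z => (hμ x y z).symm),
    conv_conv_left_comm (m₃ := (TensorProduct.mk k V₄ (V₂ ⊗[k] V₇)).compr₂
      (TensorProduct.leftComm k V₄ V₂ V₇).toLinearMap) (m₄ := TensorProduct.mk k V₂ V₇)
      (fun x y z => by simp),
    h₆, ← conv_congr_right (m₄.compl₂ (TensorProduct.lift m₆)) (fun _ _ => rfl)]
  refine (conv_assoc (fun x z w => ?_) _ _ _).symm
  induction w with
  | zero => simp
  | add x y hx hy => simp only [map_add, hx, hy]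
  | tmul y w => simp [hμ, h]

end Convolution

section Combinators

open Coalgebra

variable {k : Type} [Field k]
variable {P Q X Y Z W : Type}
  [AddCommGroup P] [Module k P] [AddCommGroup Q] [Module k Q]
  [AddCommGroup X] [Module k X] [AddCommGroup Y] [Module k Y]
  [AddCommGroup Z] [Module k Z] [AddCommGroup W] [Module k W]

/-- The bilinear map `(p, x ⊗ z) ↦ m (r p x) z`. -/
def headCompose (m : Y →ₗ[k] Z →ₗ[k] W) (r : P →ₗ[k] X →ₗ[k] Y) : P →ₗ[k] X ⊗[k] Z →ₗ[k] W :=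
  TensorProduct.curry (TensorProduct.lift m ∘ₗ (TensorProduct.lift r).rTensor Z ∘ₗ
    (TensorProduct.assoc k P X Z).symm.toLinearMap)

@[simp] lemma headCompose_tmul (m : Y →ₗ[k] Z →ₗ[k] W) (r : P →ₗ[k] X →ₗ[k] Y) (p : P) (x : X)
    (z : Z) : headCompose m r p (x ⊗ₜ z) = m (r p x) z := by
  simp [headCompose]

/-- The bilinear map `(p, q ⊗ x) ↦ m q (r p x)`. -/
def tailCompose (m : Q →ₗ[k] Y →ₗ[k] W) (r : P →ₗ[k] X →ₗ[k] Y) : P →ₗ[k] Q ⊗[k] X →ₗ[k] W :=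
  TensorProduct.curry (TensorProduct.lift m ∘ₗ (TensorProduct.lift r).lTensor Q ∘ₗ
    (TensorProduct.leftComm k P Q X).toLinearMap)

@[simp] lemma tailCompose_tmul (m : Q →ₗ[k] Y →ₗ[k] W) (r : P →ₗ[k] X →ₗ[k] Y) (p : P) (q : Q)
    (x : X) : tailCompose m r p (q ⊗ₜ x) = m q (r p x) := by
  simp [tailCompose]

/-- The bilinear map `(p ⊗ q, x) ↦ m p (r q x)`. -/
def actCompose (m : P →ₗ[k] Y →ₗ[k] W) (r : Q →ₗ[k] X →ₗ[k] Y) : P ⊗[k] Q →ₗ[k] X →ₗ[k] W :=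
  TensorProduct.curry (TensorProduct.lift m ∘ₗ (TensorProduct.lift r).lTensor P ∘ₗ
    (TensorProduct.assoc k P Q X).toLinearMap)

@[simp] lemma actCompose_tmul (m : P →ₗ[k] Y →ₗ[k] W) (r : Q →ₗ[k] X →ₗ[k] Y) (p : P) (q : Q)
    (x : X) : actCompose m r (p ⊗ₜ q) x = m p (r q x) := by
  simp [actCompose]

/-- The bilinear map `(p ⊗ q, x) ↦ m q (r p x)`. -/
def actComposeSwap (m : Q →ₗ[k] Y →ₗ[k] W) (r : P →ₗ[k] X →ₗ[k] Y) :
    P ⊗[k] Q →ₗ[k] X →ₗ[k] W :=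
  actCompose m r ∘ₗ (TensorProduct.comm k P Q).toLinearMap

@[simp] lemma actComposeSwap_tmul (m : Q →ₗ[k] Y →ₗ[k] W) (r : P →ₗ[k] X →ₗ[k] Y) (p : P) (q : Q)
    (x : X) : actComposeSwap m r (p ⊗ₜ q) x = m q (r p x) := by
  simp [actComposeSwap]

variable {X' Y' : Type} [AddCommGroup X'] [Module k X'] [AddCommGroup Y'] [Module k Y']

/-- The bilinear map `(p ⊗ q, x ⊗ y) ↦ m (r p x) (s q y)`. -/
def zipCompose (m : X' →ₗ[k] Y' →ₗ[k] W) (r : P →ₗ[k] X →ₗ[k] X') (s : Q →ₗ[k] Y →ₗ[k] Y') :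
    P ⊗[k] Q →ₗ[k] X ⊗[k] Y →ₗ[k] W :=
  TensorProduct.curry (TensorProduct.lift m ∘ₗ
    TensorProduct.map (TensorProduct.lift r) (TensorProduct.lift s) ∘ₗ
    (TensorProduct.tensorTensorTensorComm k P Q X Y).toLinearMap)

@[simp] lemma zipCompose_tmul (m : X' →ₗ[k] Y' →ₗ[k] W) (r : P →ₗ[k] X →ₗ[k] X')
    (s : Q →ₗ[k] Y →ₗ[k] Y') (p : P) (q : Q) (x : X) (y : Y) :
    zipCompose m r s (p ⊗ₜ q) (x ⊗ₜ y) = m (r p x) (s q y) := by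
  simp [zipCompose]

variable {C : Type} [AddCommGroup C] [Module k C] [Coalgebra k C]

lemma conv_headCompose (m : Y →ₗ[k] Z →ₗ[k] W) (r : P →ₗ[k] X →ₗ[k] Y) (f : C →ₗ[k] P)
    (g : C →ₗ[k] X) (h : C →ₗ[k] Z) :
    conv (headCompose m r) f (conv (TensorProduct.mk k X Z) g h) = conv m (conv r f g) h :=
  (conv_assoc (fun _ _ _ => by simp) _ _ _).symm

lemma conv_actCompose (m : P →ₗ[k] Y →ₗ[k] W) (r : Q →ₗ[k] X →ₗ[k] Y) (f : C →ₗ[k] P)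
    (g : C →ₗ[k] Q) (h : C →ₗ[k] X) :
    conv (actCompose m r) (conv (TensorProduct.mk k P Q) f g) h = conv m f (conv r g h) :=
  conv_assoc (fun _ _ _ => by simp) _ _ _

variable [IsCocomm k C]

lemma conv_tailCompose (m : Q →ₗ[k] Y →ₗ[k] W) (r : P →ₗ[k] X →ₗ[k] Y) (f : C →ₗ[k] P)
    (g : C →ₗ[k] Q) (h : C →ₗ[k] X) :
    conv (tailCompose m r) f (conv (TensorProduct.mk k Q X) g h) = conv m g (conv r f h) :=
  conv_conv_left_comm (fun _ _ _ => by simp) _ _ _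

lemma conv_actComposeSwap (m : Q →ₗ[k] Y →ₗ[k] W) (r : P →ₗ[k] X →ₗ[k] Y) (f : C →ₗ[k] P)
    (g : C →ₗ[k] Q) (h : C →ₗ[k] X) :
    conv (actComposeSwap m r) (conv (TensorProduct.mk k P Q) f g) h = conv m g (conv r f h) :=
  conv_rotate (fun _ _ _ => by simp) _ _ _

lemma conv_zipCompose (m : X' →ₗ[k] Y' →ₗ[k] W) (r : P →ₗ[k] X →ₗ[k] X')
    (s : Q →ₗ[k] Y →ₗ[k] Y') (f : C →ₗ[k] P) (g : C →ₗ[k] Q) (x : C →ₗ[k] X) (y : C →ₗ[k] Y) :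
    conv (zipCompose m r s) (conv (TensorProduct.mk k P Q) f g)
      (conv (TensorProduct.mk k X Y) x y) = conv m (conv r f x) (conv s g y) :=
  conv_interchange (fun _ _ _ _ => by simp) _ _ _ _

end Combinators

section TensorPowers

open Coalgebra

variable {k : Type} [Field k]
variable {U V W : Type} [AddCommGroup U] [Module k U] [AddCommGroup V] [Module k V]
  [AddCommGroup W] [Module k W]

/-- Prepending a tensor factor. -/
def tcons (k : Type) [Field k] (V : Type) [AddCommGroup V] [Module k V] (n : ℕ) :
    V →ₗ[k] Tpow k V n →ₗ[k] Tpow k V (n + 1) :=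
  TensorProduct.mk k V (Tpow k V n)

/-- The linear map on a tensor power with at least two factors induced by a bilinear map. -/
def tlift {n : ℕ} (m : V →ₗ[k] Tpow k V n →ₗ[k] W) : Tpow k V (n + 1) →ₗ[k] W :=
  (TensorProduct.lift m : V ⊗[k] Tpow k V n →ₗ[k] W)

@[simp] lemma tlift_tcons {n : ℕ} (m : V →ₗ[k] Tpow k V n →ₗ[k] W) (v : V) (t : Tpow k V n) :
    tlift m (tcons k V n v t) = m v t := rfl

lemma tpow_succ (n : ℕ) (f : Fin (n + 2) → V) :
    tpow k V (n + 1) f = tcons k V n (f 0) (tpow k V n fun i => f i.succ) := rfl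

lemma tpow_cons (n : ℕ) (v : V) (f : Fin (n + 1) → V) :
    tpow k V (n + 1) (Fin.cases v f) = tcons k V n v (tpow k V n f) := rfl

lemma tcons_hom_ext {n : ℕ} {f g : Tpow k V (n + 1) →ₗ[k] W}
    (h : ∀ v t, f (tcons k V n v t) = g (tcons k V n v t)) : f = g :=
  TensorProduct.ext' (M := V) (N := Tpow k V n) h

lemma tpow_hom_ext {n : ℕ} {f g : Tpow k V n →ₗ[k] W}
    (h : ∀ x, f (tpow k V n x) = g (tpow k V n x)) : f = g := by
  induction n generalizing W with
  | zero => exact LinearMap.ext fun v => h fun _ => v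
  | succ n ih =>
    refine tcons_hom_ext fun v t => ?_
    have : f ∘ₗ tcons k V n v = g ∘ₗ tcons k V n v :=
      ih fun x => h (Fin.cases (motive := fun _ => V) v x)
    exact LinearMap.congr_fun this t

lemma exists_sum_tpow (n : ℕ) (t : Tpow k V n) :
    ∃ (ι : Type) (s : Finset ι) (x : ι → Fin (n + 1) → V), ∑ i ∈ s, tpow k V n (x i) = t := by
  induction n with
  | zero => exact ⟨Unit, {()}, fun _ _ => t, by simp [tpow]⟩
  | succ n ih =>
    refine TensorProduct.induction_on (motive := fun t : V ⊗[k] Tpow k V n =>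
      ∃ (ι : Type) (s : Finset ι) (x : ι → Fin (n + 2) → V),
        ∑ i ∈ s, tpow k V (n + 1) (x i) = t) t ?_ ?_ ?_
    · exact ⟨Empty, ∅, fun _ _ => 0, rfl⟩
    · intro v t
      obtain ⟨ι, s, x, rfl⟩ := ih t
      refine ⟨ι, s, fun i => Fin.cases v (x i), ?_⟩
      simp only [tpow_cons]
      exact (map_sum (tcons k V n v) _ s).symm
    · rintro _ _ ⟨ι, s, x, rfl⟩ ⟨κ, t, y, rfl⟩
      refine ⟨ι ⊕ κ, s.disjSum t, Sum.elim x y, ?_⟩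
      rw [Finset.sum_disjSum]
      rfl

/-- The linear map `V^{⊗(n+2)} → V ⊗ V^{⊗(n+1)}` moving the last tensor factor to the front. -/
def unsnoc (k : Type) [Field k] (V : Type) [AddCommGroup V] [Module k V] :
    (n : ℕ) → Tpow k V (n + 1) →ₗ[k] V ⊗[k] Tpow k V n
  | 0 => tlift (TensorProduct.mk k V V).flip
  | n + 1 => tlift ((LinearMap.lTensorHom V ∘ₗ tcons k V n).compl₂ (unsnoc k V n))

lemma unsnoc_tpow (n : ℕ) (x : Fin (n + 2) → V) :
    unsnoc k V n (tpow k V (n + 1) x) =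
      x (Fin.last (n + 1)) ⊗ₜ[k] tpow k V n (fun i => x i.castSucc) := by
  induction n with
  | zero => rfl
  | succ n ih =>
    rw [tpow_succ]
    simp only [unsnoc, tlift_tcons, LinearMap.compl₂_apply, ih]
    rfl

/-- Acting on the first tensor factor. -/
def headAct (m : U →ₗ[k] V →ₗ[k] V) : (n : ℕ) → U →ₗ[k] Tpow k V n →ₗ[k] Tpow k V n
  | 0 => m
  | n + 1 => (LinearMap.rTensorHom (Tpow k V n) ∘ₗ m :
      U →ₗ[k] V ⊗[k] Tpow k V n →ₗ[k] V ⊗[k] Tpow k V n)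

lemma headAct_tcons (m : U →ₗ[k] V →ₗ[k] V) (n : ℕ) (u : U) (v : V) (t : Tpow k V n) :
    headAct m (n + 1) u (tcons k V n v t) = tcons k V n (m u v) t := rfl

lemma headAct_tpow (m : U →ₗ[k] V →ₗ[k] V) (n : ℕ) (u : U) (x : Fin (n + 1) → V) :
    headAct m n u (tpow k V n x) = tpow k V n (Fin.cases (m u (x 0)) fun i => x i.succ) := by
  cases n <;> rfl

/-- Splitting the first tensor factor. -/
def headSplit (φ : V →ₗ[k] U ⊗[k] V) : (n : ℕ) → Tpow k V n →ₗ[k] U ⊗[k] Tpow k V n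
  | 0 => φ
  | n + 1 => tlift (actCompose (TensorProduct.mk k U (Tpow k V (n + 1))) (tcons k V n) ∘ₗ φ)

lemma headSplit_tpow {φ : V →ₗ[k] U ⊗[k] V} {n : ℕ} {x : Fin (n + 1) → V} {ι : Type}
    {s : Finset ι} {u : ι → U} {v : ι → V} (h : φ (x 0) = ∑ i ∈ s, u i ⊗ₜ v i) :
    headSplit φ n (tpow k V n x) =
      ∑ i ∈ s, u i ⊗ₜ tpow k V n (Fin.cases (v i) fun j => x j.succ) := by
  cases n with
  | zero => exact h
  | succ n =>
    rw [tpow_succ]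
    simp only [headSplit, tlift_tcons, LinearMap.comp_apply, h, map_sum, LinearMap.sum_apply,
      actCompose_tmul, tpow_cons, TensorProduct.mk_apply]

variable {C : Type} [AddCommGroup C] [Module k C] [Coalgebra k C]

/-- The convolution `c ↦ f 0 c⁽¹⁾ ⊗ ⋯ ⊗ f n c⁽ⁿ⁺¹⁾`. -/
def convTpow : (n : ℕ) → (Fin (n + 1) → C →ₗ[k] V) → C →ₗ[k] Tpow k V n
  | 0, f => f 0
  | n + 1, f => conv (tcons k V n) (f 0) (convTpow n fun i => f i.succ)

lemma convTpow_succ (n : ℕ) (f : Fin (n + 2) → C →ₗ[k] V) :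
    convTpow (n + 1) f = conv (tcons k V n) (f 0) (convTpow n fun i => f i.succ) := rfl

lemma convTpow_comp {D : Type} [AddCommGroup D] [Module k D] [Coalgebra k D] (n : ℕ)
    (f : Fin (n + 1) → C →ₗ[k] V) (q : D →ₗc[k] C) :
    convTpow n f ∘ₗ (q : D →ₗ[k] C) = convTpow n fun i => f i ∘ₗ (q : D →ₗ[k] C) := by
  induction n with
  | zero => rfl
  | succ n ih => rw [convTpow_succ, conv_comp, ih, convTpow_succ]

lemma conv_headAct (m : U →ₗ[k] V →ₗ[k] V) (n : ℕ) (f : C →ₗ[k] U) (x : Fin (n + 1) → C →ₗ[k] V) :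
    conv (headAct m n) f (convTpow n x) =
      convTpow n (Fin.cases (conv m f (x 0)) fun i => x i.succ) := by
  cases n with
  | zero => rfl
  | succ n => exact (conv_assoc (fun _ _ _ => (headAct_tcons m n _ _ _).symm) _ _ _).symm

lemma headSplit_comp_convTpow {φ : V →ₗ[k] U ⊗[k] V} {n : ℕ} {s : C →ₗ[k] U}
    {x : Fin (n + 1) → C →ₗ[k] V} (h : φ ∘ₗ x 0 = conv (TensorProduct.mk k U V) s (x 0)) :
    headSplit φ n ∘ₗ convTpow n x = conv (TensorProduct.mk k U (Tpow k V n)) s (convTpow n x) := by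
  cases n with
  | zero => exact h
  | succ n =>
    rw [convTpow_succ, comp_conv (φ := headSplit φ (n + 1))
      (m' := actCompose (TensorProduct.mk k U (Tpow k V (n + 1))) (tcons k V n)) (u := φ)
      (v := LinearMap.id) (fun _ _ => rfl), h, LinearMap.id_comp]
    exact conv_actCompose _ _ _ _ _

variable [IsCocomm k C]

lemma unsnoc_comp_convTpow (n : ℕ) (x : Fin (n + 2) → C →ₗ[k] V) :
    unsnoc k V n ∘ₗ convTpow (n + 1) x = conv (TensorProduct.mk k V (Tpow k V n))
      (x (Fin.last (n + 1))) (convTpow n fun i => x i.castSucc) := by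
  induction n with
  | zero =>
    exact (comp_conv (φ := unsnoc k V 0) (m := tcons k V 0) (m' := (TensorProduct.mk k V V).flip)
      (u := LinearMap.id) (v := LinearMap.id) (fun _ _ => rfl) (x 0) (x 1)).trans
      (conv_comm (fun _ _ => rfl) _ _)
  | succ n ih =>
    rw [convTpow_succ, comp_conv (m' := LinearMap.lTensorHom V ∘ₗ tcons k V n)
      (u := LinearMap.id) (v := unsnoc k V n) (fun _ _ => rfl), ih]
    exact conv_conv_left_comm (fun _ _ _ => rfl) _ _ _

end TensorPowers

section Action

open Coalgebra

variable {k : Type} [Field k]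
variable {C : Type} [AddCommGroup C] [Module k C] [Coalgebra k C]
variable {V W : Type} [AddCommGroup V] [Module k V] [AddCommGroup W] [Module k W]
variable {B : Type} [Ring B] [Algebra k B]

/-- The convolution product of two linear maps from a coalgebra to an algebra. -/
def convMul (f g : C →ₗ[k] B) : C →ₗ[k] B := conv (LinearMap.mul k B) f g

/-- The unit of the convolution product. -/
def convOne : C →ₗ[k] B := Algebra.linearMap k B ∘ₗ counit

notation:70 f:70 " ⊡ " g:71 => convMul f g

lemma convMul_assoc (f g h : C →ₗ[k] B) : f ⊡ g ⊡ h = f ⊡ (g ⊡ h) :=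
  conv_assoc (fun x y z => by simp [mul_assoc]) f g h

lemma conv_convOne_left {m : B →ₗ[k] V →ₗ[k] V} (hm : ∀ v, m 1 v = v) (f : C →ₗ[k] V) :
    conv m convOne f = f := by
  ext c
  have h (w : C ⊗[k] C) : TensorProduct.lift m (TensorProduct.map convOne f w) =
      f (TensorProduct.lid k C (counit.rTensor C w)) := by
    induction w with
    | zero => simp
    | add x y hx hy => simp only [map_add, hx, hy]
    | tmul x y => simp [convOne, Algebra.algebraMap_eq_smul_one, hm]
  rw [conv_apply, h, rTensor_counit_comul, TensorProduct.lid_tmul, one_smul]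

lemma convOne_convMul (f : C →ₗ[k] B) : convOne ⊡ f = f :=
  conv_convOne_left (fun v => one_mul v) f

variable {H : Type} [Ring H] [HopfAlgebra k H]

/-- A linear map into `H` compatible with the comultiplications and the counits. -/
structure IsCoalgMap (γ : C →ₗ[k] H) : Prop where
  comul_comp : comul ∘ₗ γ = conv (TensorProduct.mk k H H) γ γ
  counit_comp : (counit ∘ₗ γ : C →ₗ[k] k) = counit

lemma IsCoalgMap.comp {D : Type} [AddCommGroup D] [Module k D] [Coalgebra k D]
    {γ : C →ₗ[k] H} (hγ : IsCoalgMap γ) (q : D →ₗc[k] C) :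
    IsCoalgMap (γ ∘ₗ (q : D →ₗ[k] C)) where
  comul_comp := by rw [← LinearMap.comp_assoc, hγ.comul_comp, conv_comp]
  counit_comp := by
    rw [← LinearMap.comp_assoc, hγ.counit_comp]
    ext d
    exact CoalgHomClass.counit_comp_apply q d

lemma isCoalgMap_id : IsCoalgMap (LinearMap.id : H →ₗ[k] H) where
  comul_comp := by
    ext h
    simp only [LinearMap.comp_apply, LinearMap.id_apply, conv_apply, TensorProduct.map_id]
    generalize (comul h : H ⊗[k] H) = w
    induction w with
    | zero => simp
    | add x y hx hy => simp only [map_add, ← hx, ← hy]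
    | tmul x y => simp
  counit_comp := rfl

lemma IsCoalgMap.convMul [IsCocomm k C] {γ δ : C →ₗ[k] H} (hγ : IsCoalgMap γ)
    (hδ : IsCoalgMap δ) : IsCoalgMap (γ ⊡ δ) where
  comul_comp := by
    unfold _root_.convMul
    rw [comp_conv (m' := LinearMap.mul k (H ⊗[k] H)) (u := comul) (v := comul)
      (fun x y => Bialgebra.comul_mul x y), hγ.comul_comp, hδ.comul_comp]
    exact conv_interchange (fun _ _ _ _ => by simp) _ _ _ _
  counit_comp := by
    unfold _root_.convMul
    rw [comp_conv (m' := LinearMap.mul k k) (u := counit) (v := counit)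
      (fun x y => Bialgebra.counit_mul x y), hγ.counit_comp, hδ.counit_comp]
    exact convOne_convMul (B := k) counit

/-- Composition with the antipode. -/
def antipodeComp (γ : C →ₗ[k] H) : C →ₗ[k] H := HopfAlgebra.antipode k ∘ₗ γ

lemma IsCoalgMap.antipodeComp_convMul_self {γ : C →ₗ[k] H} (hγ : IsCoalgMap γ) :
    antipodeComp γ ⊡ γ = convOne := by
  have h : (LinearMap.mul' k H ∘ₗ (HopfAlgebra.antipode k).rTensor H) ∘ₗ
      conv (TensorProduct.mk k H H) γ γ = antipodeComp γ ⊡ γ :=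
    comp_conv (m' := LinearMap.mul k H) (u := HopfAlgebra.antipode k) (v := LinearMap.id)
      (fun _ _ => by simp) γ γ
  rw [← h, ← hγ.comul_comp, convOne, ← hγ.counit_comp]
  exact LinearMap.ext fun c => HopfAlgebra.mul_antipode_rTensor_comul_apply (γ c)

lemma IsCoalgMap.convMul_antipodeComp {γ : C →ₗ[k] H} (hγ : IsCoalgMap γ) :
    γ ⊡ antipodeComp γ = convOne := by
  have h : (LinearMap.mul' k H ∘ₗ (HopfAlgebra.antipode k).lTensor H) ∘ₗ
      conv (TensorProduct.mk k H H) γ γ = γ ⊡ antipodeComp γ :=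
    comp_conv (m' := LinearMap.mul k H) (u := LinearMap.id) (v := HopfAlgebra.antipode k)
      (fun _ _ => by simp) γ γ
  rw [← h, ← hγ.comul_comp, convOne, ← hγ.counit_comp]
  exact LinearMap.ext fun c => HopfAlgebra.mul_antipode_lTensor_comul_apply (γ c)

lemma antipodeComp_convMul [IsCocomm k C] (γ δ : C →ₗ[k] H) :
    antipodeComp (γ ⊡ δ) = antipodeComp δ ⊡ antipodeComp γ := by
  refine (comp_conv (m' := (LinearMap.mul k H).flip) (u := HopfAlgebra.antipode k)
    (v := HopfAlgebra.antipode k) (fun x y => ?_) γ δ).trans (conv_comm (fun _ _ => rfl) _ _)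
  exact HopfAlgebra.antipode_mul_antidistrib x y

variable {A : Type} [Ring A] [Algebra k A] {rho : H →ₗ[k] A →ₗ[k] A}

lemma exists_iterRepr (n : ℕ) (h : H) : Nonempty (IterRepr k H n h) := by
  obtain ⟨ι, s, x, hx⟩ := exists_sum_tpow n (comulIter k H n h)
  exact ⟨ι, s, x, hx⟩

lemma comulIter_one : comulIter k H 1 = (comul : H →ₗ[k] H ⊗[k] H) :=
  congrArg (· ∘ₗ (comul : H →ₗ[k] H ⊗[k] H)) (LinearMap.lTensor_id H H)

lemma IsModuleAlgebraAction.one_apply (hma : IsModuleAlgebraAction k H A rho) (a : A) :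
    rho 1 a = a := hma.1.2.2 a

lemma conv_rho_conv_rho (hma : IsModuleAlgebraAction k H A rho) (γ δ : C →ₗ[k] H)
    (α : C →ₗ[k] A) : conv rho γ (conv rho δ α) = conv rho (γ ⊡ δ) α :=
  (conv_assoc (fun x y z => hma.2 x y z) γ δ α).symm

lemma conv_rho_convOne (hma : IsModuleAlgebraAction k H A rho) (α : C →ₗ[k] A) :
    conv rho convOne α = α :=
  conv_convOne_left hma.one_apply α

lemma IsCoalgMap.conv_rho_convMul [IsCocomm k C] (hma : IsModuleAlgebraAction k H A rho)
    {γ : C →ₗ[k] H} (hγ : IsCoalgMap γ) (α β : C →ₗ[k] A) :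
    conv rho γ (α ⊡ β) = conv rho γ α ⊡ conv rho γ β := by
  let N := zipCompose (LinearMap.mul k A) rho rho
  have hN (h : H) (z : A ⊗[k] A) : rho h (LinearMap.mul' k A z) = N (comul h) z := by
    obtain ⟨R⟩ : Nonempty (IterRepr k H 1 h) := exists_iterRepr 1 h
    have hR : comul h = ∑ i ∈ R.s, R.leg i 0 ⊗ₜ[k] R.leg i 1 := by
      exact (LinearMap.congr_fun comulIter_one h).symm.trans R.eq.symm
    induction z with
    | zero => simp
    | add x y hx hy => simp only [map_add, hx, hy]
    | tmul a b => simp [N, hR, hma.1.1 h a b R]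
  have h : α ⊡ β = LinearMap.mul' k A ∘ₗ conv (TensorProduct.mk k A A) α β :=
    (comp_conv (u := LinearMap.id) (v := LinearMap.id) (fun _ _ => rfl) α β).symm
  rw [h, ← conv_congr_right (rho.compl₂ (LinearMap.mul' k A)) (fun _ _ => rfl),
    conv_congr_left _ (m' := N) hN, hγ.comul_comp]
  exact conv_zipCompose ..

lemma IsCoalgMap.conv_rho_antipodeComp_cancel (hma : IsModuleAlgebraAction k H A rho)
    {γ : C →ₗ[k] H} (hγ : IsCoalgMap γ) (α : C →ₗ[k] A) :
    conv rho γ (conv rho (antipodeComp γ) α) = α := by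
  rw [conv_rho_conv_rho hma, hγ.convMul_antipodeComp, conv_rho_convOne hma]

lemma IsCoalgMap.conv_rho_antipodeComp_convMul [IsCocomm k C]
    (hma : IsModuleAlgebraAction k H A rho) {γ : C →ₗ[k] H} (hγ : IsCoalgMap γ) (α β : C →ₗ[k] A) :
    conv rho (antipodeComp γ) (α ⊡ β) =
      conv rho (antipodeComp γ) α ⊡ conv rho (antipodeComp γ) β := by
  conv_lhs => rw [← hγ.conv_rho_antipodeComp_cancel hma α, ← hγ.conv_rho_antipodeComp_cancel hma β,
    ← hγ.conv_rho_convMul hma, conv_rho_conv_rho hma, hγ.antipodeComp_convMul_self,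
    conv_rho_convOne hma]

lemma conv_map_smul [IsCocomm k C] (m : V →ₗ[k] W →ₗ[k] B) (f : C →ₗ[k] V) (s : C →ₗ[k] k)
    (g : C →ₗ[k] W) :
    conv m f (conv (LinearMap.lsmul k W) s g) = conv (LinearMap.lsmul k B) s (conv m f g) :=
  conv_conv_left_comm (fun _ _ _ => by simp) _ _ _

end Action

section Operators

open Coalgebra

variable {k : Type} [Field k] {H : Type} [Ring H] [HopfAlgebra k H]
variable {A : Type} [Ring A] [Algebra k A] (rho : H →ₗ[k] A →ₗ[k] A) (sg : H →ₗ[k] H →ₗ[k] k)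

/-- The convolution product of a nonempty family. -/
def convProd {C : Type} [AddCommGroup C] [Module k C] [Coalgebra k C] :
    (n : ℕ) → (Fin (n + 1) → C →ₗ[k] H) → C →ₗ[k] H
  | 0, f => f 0
  | n + 1, f => f 0 ⊡ convProd n fun i => f i.succ

/-- `g₀ ⊗ ⋯ ⊗ gₙ ↦ g₀⁽¹⁾⋯gₙ⁽¹⁾ ⊗ (g₀⁽²⁾ ⊗ ⋯ ⊗ gₙ⁽²⁾)`. -/
def splitProd (k : Type) [Field k] (H : Type) [Ring H] [HopfAlgebra k H] :
    (n : ℕ) → Tpow k H n →ₗ[k] H ⊗[k] Tpow k H n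
  | 0 => (comul : H →ₗ[k] H ⊗[k] H)
  | n + 1 => tlift ((zipCompose (TensorProduct.mk k H (Tpow k H (n + 1))) (LinearMap.mul k H)
      (tcons k H n)).compl₁₂ comul (splitProd k H n))

/-- `(h ⊗ a) ↦ S(h)(a)`. -/
def antipodeAct : H →ₗ[k] A →ₗ[k] A := rho ∘ₗ HopfAlgebra.antipode k

/-- The diagonal action of the first legs of `h₀ ⊗ ⋯ ⊗ hₙ₊₂` on `a₀ ⊗ ⋯ ⊗ aₙ`, keeping the last
two legs. -/
def diagAct : (n : ℕ) → Tpow k H (n + 2) →ₗ[k] Tpow k A n →ₗ[k] Tpow k A n ⊗[k] (H ⊗[k] H)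
  | 0 => actComposeSwap (TensorProduct.mk k A (H ⊗[k] H)).flip rho
  | n + 1 => zipCompose (LinearMap.rTensorHom (H ⊗[k] H) ∘ₗ tcons k A n) rho (diagAct n)

/-- The last vertical face. -/
def lastVerFace (m n : ℕ) :
    Tpow k H m ⊗[k] Tpow k A (n + 1) →ₗ[k] Tpow k H m ⊗[k] Tpow k A n :=
  TensorProduct.lift ((actComposeSwap (TensorProduct.mk k (Tpow k H m) (Tpow k A n))
    (headCompose (headAct (LinearMap.mul k A) n) (antipodeAct rho))).compl₁₂
      (splitProd k H m) (unsnoc k A n))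

/-- The bilinear map
`(t, b ⊗ (h ⊗ h')) ↦ (h t₀⁽¹⁾ ⊗ t₁ ⊗ ⋯ ⊗ tₙ) ⊗ (σ(h', t₀⁽²⁾) b₀ ⊗ b₁ ⊗ ⋯ ⊗ bₙ)`. -/
def horFaceMerge (n q : ℕ) :
    Tpow k H n →ₗ[k] Tpow k A q ⊗[k] (H ⊗[k] H) →ₗ[k] Tpow k H n ⊗[k] Tpow k A q :=
  actComposeSwap
    (headCompose (TensorProduct.mk k (Tpow k H n) (Tpow k A q))
      (headAct (LinearMap.mul k H) n).flip)
    (tailCompose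
      (tailCompose (TensorProduct.mk k H (Tpow k A q)) (headAct (LinearMap.lsmul k A) q).flip)
      (tailCompose (TensorProduct.mk k H k) sg.flip)) ∘ₗ
  headSplit ((TensorProduct.comm k H H).toLinearMap ∘ₗ comul) n

/-- The last horizontal face. -/
def lastHorFace (n q : ℕ) :
    Tpow k H (n + 1) ⊗[k] Tpow k A q →ₗ[k] Tpow k H n ⊗[k] Tpow k A q :=
  TensorProduct.lift (actComposeSwap (horFaceMerge sg n q)
    (diagAct rho q ∘ₗ comulIter k H (q + 2)) ∘ₗ unsnoc k H n)

/-- The multiplication of the crossed product. -/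
def crossedMul : A ⊗[k] H →ₗ[k] A ⊗[k] H →ₗ[k] A ⊗[k] H :=
  actCompose (headCompose (TensorProduct.mk k A H) (LinearMap.mul k A))
    (actComposeSwap
      (tailCompose (headCompose (TensorProduct.mk k A H) (LinearMap.lsmul k A).flip)
        ((zipCompose (TensorProduct.mk k k H) sg (LinearMap.mul k H)).compl₁₂ comul comul))
      (headCompose (TensorProduct.mk k A H) rho) ∘ₗ comul)

/-- The last face of the cyclic module of an algebra. -/
def algLastFace {X : Type} [AddCommGroup X] [Module k X] (mul : X →ₗ[k] X →ₗ[k] X) (n : ℕ) :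
    Tpow k X (n + 1) →ₗ[k] Tpow k X n :=
  TensorProduct.lift (headAct mul n) ∘ₗ unsnoc k X n

/-- The map `Φ`. -/
def phi : (n : ℕ) → Tpow k (A ⊗[k] H) n →ₗ[k] Tpow k H n ⊗[k] Tpow k A n
  | 0 => TensorProduct.lift
      (actComposeSwap (TensorProduct.mk k H A) (antipodeAct rho) ∘ₗ comul).flip
  | n + 1 => tlift ((zipCompose
      (actComposeSwap (TensorProduct.mk k (Tpow k H (n + 1)) (Tpow k A (n + 1)))
        (headCompose (tcons k A n) (antipodeAct rho)) ∘ₗ splitProd k H (n + 1))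
      (tcons k H n) (TensorProduct.mk k A (Tpow k A n)) ∘ₗ
        (TensorProduct.comm k A H).toLinearMap).compl₂ (phi n))

/-! ### Evaluation on convolutions of coalgebra maps -/

variable {C : Type} [AddCommGroup C] [Module k C] [Coalgebra k C]
variable {rho sg}

lemma conv_antipodeAct (γ : C →ₗ[k] H) (α : C →ₗ[k] A) :
    conv (antipodeAct rho) γ α = conv rho (antipodeComp γ) α :=
  conv_comp_left rho _ γ α

lemma comulIter_succ_comp (n : ℕ) {γ : C →ₗ[k] H} (hγ : IsCoalgMap γ) :
    comulIter k H (n + 1) ∘ₗ γ = conv (tcons k H n) γ (comulIter k H n ∘ₗ γ) := by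
  have h : comulIter k H (n + 1) ∘ₗ γ = LinearMap.lTensor H (comulIter k H n) ∘ₗ comul ∘ₗ γ := rfl
  rw [h, hγ.comul_comp]
  exact comp_conv (u := LinearMap.id) (fun _ _ => rfl) γ γ

variable [IsCocomm k C]

lemma splitProd_comp_convTpow (n : ℕ) {γ : Fin (n + 1) → C →ₗ[k] H}
    (hγ : ∀ i, IsCoalgMap (γ i)) :
    splitProd k H n ∘ₗ convTpow n γ =
      conv (TensorProduct.mk k H (Tpow k H n)) (convProd n γ) (convTpow n γ) := by
  induction n with
  | zero => exact (hγ 0).comul_comp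
  | succ n ih =>
    rw [convTpow_succ, comp_conv (φ := splitProd k H (n + 1)) (m' := zipCompose
      (TensorProduct.mk k H (Tpow k H (n + 1))) (LinearMap.mul k H) (tcons k H n)) (u := comul)
      (v := splitProd k H n) (fun _ _ => rfl), (hγ 0).comul_comp, ih fun i => hγ i.succ,
      conv_zipCompose]
    rfl

lemma conv_diagAct (n : ℕ) {γ : C →ₗ[k] H} (hγ : IsCoalgMap γ) (β : Fin (n + 1) → C →ₗ[k] A) :
    conv (diagAct rho n) (comulIter k H (n + 2) ∘ₗ γ) (convTpow n β) =
      conv (TensorProduct.mk k (Tpow k A n) (H ⊗[k] H)) (convTpow n fun i => conv rho γ (β i))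
        (conv (TensorProduct.mk k H H) γ γ) := by
  induction n with
  | zero =>
    have h : comulIter k H 1 ∘ₗ γ = conv (TensorProduct.mk k H H) γ γ :=
      (congrArg (· ∘ₗ γ) comulIter_one).trans hγ.comul_comp
    rw [comulIter_succ_comp _ hγ, h]
    exact (conv_actComposeSwap _ _ _ _ _).trans (conv_flip _ _ _)
  | succ n ih =>
    rw [comulIter_succ_comp _ hγ, convTpow_succ]
    refine (conv_zipCompose _ _ _ _ _ _ _).trans ?_
    rw [ih]
    exact (conv_assoc (fun _ _ _ => rfl) _ _ _).symm

lemma lastVerFace_comp_conv (m n : ℕ) {γ : Fin (m + 1) → C →ₗ[k] H} (hγ : ∀ i, IsCoalgMap (γ i))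
    (β : Fin (n + 2) → C →ₗ[k] A) :
    lastVerFace rho m n ∘ₗ conv (TensorProduct.mk k _ _) (convTpow m γ) (convTpow (n + 1) β) =
      conv (TensorProduct.mk k _ _) (convTpow m γ) (convTpow n (Fin.cases
        (conv rho (antipodeComp (convProd m γ)) (β (Fin.last (n + 1))) ⊡ β 0)
        fun i => β i.succ.castSucc)) := by
  rw [comp_conv (m' := actComposeSwap (TensorProduct.mk k (Tpow k H m) (Tpow k A n))
      (headCompose (headAct (LinearMap.mul k A) n) (antipodeAct rho)))
    (u := splitProd k H m) (v := unsnoc k A n) (fun _ _ => rfl), splitProd_comp_convTpow m hγ,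
    unsnoc_comp_convTpow, conv_actComposeSwap, conv_headCompose, conv_antipodeAct, conv_headAct]
  rfl

lemma conv_horFaceMerge (n q : ℕ) {γ : Fin (n + 1) → C →ₗ[k] H} (hγ : ∀ i, IsCoalgMap (γ i))
    (u : C →ₗ[k] H) (β : Fin (q + 1) → C →ₗ[k] A) :
    conv (horFaceMerge sg n q) (convTpow n γ) (conv (TensorProduct.mk k _ _) (convTpow q β)
      (conv (TensorProduct.mk k H H) u u)) =
      conv (TensorProduct.mk k _ _) (convTpow n (Fin.cases (u ⊡ γ 0) fun i => γ i.succ))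
        (convTpow q (Fin.cases (conv (LinearMap.lsmul k A) (conv sg u (γ 0)) (β 0))
          fun i => β i.succ)) := by
  have hsplit : headSplit ((TensorProduct.comm k H H).toLinearMap ∘ₗ comul) n ∘ₗ convTpow n γ =
      conv (TensorProduct.mk k _ _) (γ 0) (convTpow n γ) := by
    refine headSplit_comp_convTpow ?_
    rw [LinearMap.comp_assoc, (hγ 0).comul_comp]
    exact (comp_conv (m' := (TensorProduct.mk k H H).flip) (u := LinearMap.id)
      (v := LinearMap.id) (fun _ _ => rfl) _ _).trans (conv_comm (fun _ _ => rfl) _ _)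
  rw [horFaceMerge, conv_comp_left, hsplit, conv_actComposeSwap,
    conv_tailCompose, conv_tailCompose,
    conv_flip, conv_tailCompose,
    conv_flip, conv_headAct,
    conv_headCompose,
    conv_flip, conv_headAct]
  rfl

lemma lastHorFace_comp_conv (n q : ℕ) {γ : Fin (n + 2) → C →ₗ[k] H}
    (hγ : ∀ i, IsCoalgMap (γ i)) (β : Fin (q + 1) → C →ₗ[k] A) :
    lastHorFace rho sg n q ∘ₗ
        conv (TensorProduct.mk k _ _) (convTpow (n + 1) γ) (convTpow q β) =
      conv (TensorProduct.mk k _ _)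
        (convTpow n (Fin.cases (γ (Fin.last (n + 1)) ⊡ γ 0) fun i => γ i.succ.castSucc))
        (convTpow q (Fin.cases
          (conv (LinearMap.lsmul k A) (conv sg (γ (Fin.last (n + 1))) (γ 0))
            (conv rho (γ (Fin.last (n + 1))) (β 0)))
          fun i => conv rho (γ (Fin.last (n + 1))) (β i.succ))) := by
  rw [comp_conv (m' := actComposeSwap (horFaceMerge sg n q)
      (diagAct rho q ∘ₗ comulIter k H (q + 2))) (u := unsnoc k H n) (v := LinearMap.id)
      (fun _ _ => rfl), unsnoc_comp_convTpow, LinearMap.id_comp, conv_actComposeSwap,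
    conv_comp_left,
    conv_diagAct _ (hγ _), conv_horFaceMerge _ _ fun i => hγ i.castSucc]
  rfl

lemma crossedMul_conv {γ γ' : C →ₗ[k] H} (hγ : IsCoalgMap γ) (hγ' : IsCoalgMap γ')
    (α α' : C →ₗ[k] A) :
    conv (crossedMul rho sg) (conv (TensorProduct.mk k A H) α γ)
        (conv (TensorProduct.mk k A H) α' γ') =
      conv (TensorProduct.mk k A H)
        (α ⊡ conv (LinearMap.lsmul k A) (conv sg γ γ') (conv rho γ α')) (γ ⊡ γ') := by
  rw [crossedMul, conv_actCompose, conv_comp_left, hγ.comul_comp, conv_actComposeSwap,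
    conv_headCompose, conv_tailCompose, conv_compl₁₂, hγ.comul_comp, hγ'.comul_comp,
    conv_zipCompose, conv_headCompose, conv_flip, conv_headCompose]
  rfl

lemma algLastFace_comp_convTpow {X : Type} [AddCommGroup X] [Module k X]
    (mul : X →ₗ[k] X →ₗ[k] X) (n : ℕ) (x : Fin (n + 2) → C →ₗ[k] X) :
    algLastFace mul n ∘ₗ convTpow (n + 1) x = convTpow n (Fin.cases
      (conv mul (x (Fin.last (n + 1))) (x 0)) fun i => x i.succ.castSucc) := by
  rw [algLastFace, LinearMap.comp_assoc, unsnoc_comp_convTpow,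
    comp_conv (m' := headAct mul n) (u := LinearMap.id) (v := LinearMap.id) (fun _ _ => rfl)]
  exact conv_headAct _ _ _ _

/-- The convolution products `f i * f (i+1) * ⋯ * f n`. -/
def convTailProd : (n : ℕ) → (Fin (n + 1) → C →ₗ[k] H) → Fin (n + 1) → C →ₗ[k] H
  | 0, f => f
  | n + 1, f => Fin.cases (convProd (n + 1) f) (convTailProd n fun i => f i.succ)

lemma phi_comp_convTpow (n : ℕ) {γ : Fin (n + 1) → C →ₗ[k] H} (hγ : ∀ i, IsCoalgMap (γ i))
    (α : Fin (n + 1) → C →ₗ[k] A) :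
    phi rho n ∘ₗ convTpow n (fun i => conv (TensorProduct.mk k A H) (α i) (γ i)) =
      conv (TensorProduct.mk k _ _) (convTpow n γ)
        (convTpow n fun i => conv rho (antipodeComp (convTailProd n γ i)) (α i)) := by
  induction n with
  | zero =>
    refine (comp_conv (m' := (actComposeSwap (TensorProduct.mk k H A) (antipodeAct rho)).flip)
      (u := LinearMap.id) (v := comul) (fun _ _ => rfl) _ _).trans ?_
    rw [(hγ 0).comul_comp, conv_flip, conv_actComposeSwap, conv_antipodeAct]
    rfl
  | succ n ih =>
    rw [convTpow_succ, comp_conv (φ := phi rho (n + 1)) (m' := zipCompose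
      (actComposeSwap (TensorProduct.mk k (Tpow k H (n + 1)) (Tpow k A (n + 1)))
        (headCompose (tcons k A n) (antipodeAct rho)) ∘ₗ splitProd k H (n + 1))
      (tcons k H n) (TensorProduct.mk k A (Tpow k A n)))
      (u := (TensorProduct.comm k A H).toLinearMap) (v := phi rho n) (fun _ _ => rfl),
      ih fun i => hγ i.succ]
    have hcomm : (TensorProduct.comm k A H).toLinearMap ∘ₗ
        conv (TensorProduct.mk k A H) (α 0) (γ 0) =
          conv (TensorProduct.mk k H A) (γ 0) (α 0) :=
      (comp_conv (m' := (TensorProduct.mk k H A).flip) (u := LinearMap.id)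
        (v := LinearMap.id) (fun _ _ => rfl) _ _).trans (conv_comm (fun _ _ => rfl) _ _)
    rw [hcomm, conv_zipCompose, ← convTpow_succ,
      conv_comp_left,
      splitProd_comp_convTpow _ hγ, conv_actComposeSwap, conv_headCompose, conv_antipodeAct]
    rfl

end Operators

section Intertwining

open Coalgebra

variable {k : Type} [Field k] {H : Type} [Ring H] [HopfAlgebra k H]
variable {C : Type} [AddCommGroup C] [Module k C] [Coalgebra k C]

lemma convProd_eq_mul_last (n : ℕ) (f : Fin (n + 2) → C →ₗ[k] H) :
    convProd (n + 1) f = convProd n (fun i => f i.castSucc) ⊡ f (Fin.last (n + 1)) := by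
  induction n with
  | zero => rfl
  | succ n ih =>
    rw [convProd, ih]
    exact (convMul_assoc _ _ _).symm

lemma convProd_mul_head (n : ℕ) (u : C →ₗ[k] H) (f : Fin (n + 1) → C →ₗ[k] H) :
    convProd n (Fin.cases (u ⊡ f 0) fun i => f i.succ) = u ⊡ convProd n f := by
  cases n with
  | zero => rfl
  | succ n => exact convMul_assoc _ _ _

lemma convTailProd_zero (n : ℕ) (f : Fin (n + 1) → C →ₗ[k] H) :
    convTailProd n f 0 = convProd n f := by
  cases n <;> rfl

lemma convTailProd_last (n : ℕ) (f : Fin (n + 1) → C →ₗ[k] H) :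
    convTailProd n f (Fin.last n) = f (Fin.last n) := by
  induction n with
  | zero => rfl
  | succ n ih => exact ih _

lemma convTailProd_castSucc (n : ℕ) (f : Fin (n + 2) → C →ₗ[k] H) (i : Fin (n + 1)) :
    convTailProd (n + 1) f i.castSucc =
      convTailProd n (fun i => f i.castSucc) i ⊡ f (Fin.last (n + 1)) := by
  induction n with
  | zero =>
    obtain rfl : i = 0 := Fin.fin_one_eq_zero i
    rfl
  | succ n ih =>
    cases i using Fin.cases with
    | zero => exact convProd_eq_mul_last _ _
    | succ i => exact ih (fun i => f i.succ) i

lemma convTailProd_succ_congr {n : ℕ} {f g : Fin (n + 1) → C →ₗ[k] H}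
    (h : ∀ i : Fin n, f i.succ = g i.succ) (i : Fin n) :
    convTailProd n f i.succ = convTailProd n g i.succ := by
  cases n with
  | zero => exact i.elim0
  | succ n => exact congrArg (fun f => convTailProd n f i) (funext h)

variable [IsCocomm k C]

lemma isCoalgMap_convProd (n : ℕ) {f : Fin (n + 1) → C →ₗ[k] H} (hf : ∀ i, IsCoalgMap (f i)) :
    IsCoalgMap (convProd n f) := by
  induction n with
  | zero => exact hf 0
  | succ n ih => exact (hf 0).convMul (ih fun i => hf i.succ)

variable {A : Type} [Ring A] [Algebra k A] {rho : H →ₗ[k] A →ₗ[k] A} {sg : H →ₗ[k] H →ₗ[k] k}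

lemma IsCoalgMap.conv_rho_antipodeComp_mul_cancel (hma : IsModuleAlgebraAction k H A rho)
    {u : C →ₗ[k] H} (hu : IsCoalgMap u) (f : C →ₗ[k] H) (α : C →ₗ[k] A) :
    conv rho u (conv rho (antipodeComp (f ⊡ u)) α) = conv rho (antipodeComp f) α := by
  rw [antipodeComp_convMul, ← conv_rho_conv_rho hma, hu.conv_rho_antipodeComp_cancel hma]

lemma phi_intertwines_on_convTpow (hma : IsModuleAlgebraAction k H A rho) (n : ℕ)
    {γ : Fin (n + 2) → C →ₗ[k] H} (hγ : ∀ i, IsCoalgMap (γ i)) (α : Fin (n + 2) → C →ₗ[k] A) :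
    ((lastHorFace rho sg n n ∘ₗ lastVerFace rho (n + 1) n) ∘ₗ phi rho (n + 1)) ∘ₗ
        convTpow (n + 1) (fun i => conv (TensorProduct.mk k A H) (α i) (γ i)) =
      (phi rho n ∘ₗ algLastFace (crossedMul rho sg) n) ∘ₗ
        convTpow (n + 1) (fun i => conv (TensorProduct.mk k A H) (α i) (γ i)) := by
  set u := γ (Fin.last (n + 1))
  have hu : IsCoalgMap u := hγ _
  set f : Fin (n + 1) → C →ₗ[k] H := fun i => γ i.castSucc
  set γ' : Fin (n + 1) → C →ₗ[k] H := Fin.cases (u ⊡ γ 0) fun i => γ i.succ.castSucc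
  have hγ' (i) : IsCoalgMap (γ' i) := by
    cases i using Fin.cases with
    | zero => exact hu.convMul (hγ 0)
    | succ i => exact hγ _
  have hf : IsCoalgMap (convProd n f) := isCoalgMap_convProd n fun i => hγ _
  have hprod : convProd n γ' = u ⊡ convProd n f := convProd_mul_head n u f
  let α' : Fin (n + 1) → C →ₗ[k] A := Fin.cases
    (α (Fin.last (n + 1)) ⊡ conv (LinearMap.lsmul k A) (conv sg u (γ 0)) (conv rho u (α 0)))
    fun i => α i.succ.castSucc
  have hface : algLastFace (crossedMul rho sg) n ∘ₗ
      convTpow (n + 1) (fun i => conv (TensorProduct.mk k A H) (α i) (γ i)) =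
        convTpow n fun i => conv (TensorProduct.mk k A H) (α' i) (γ' i) := by
    rw [algLastFace_comp_convTpow, crossedMul_conv hu (hγ 0)]
    congr 1
    funext i
    cases i using Fin.cases <;> rfl
  rw [LinearMap.comp_assoc, LinearMap.comp_assoc, phi_comp_convTpow _ hγ,
    lastVerFace_comp_conv _ _ hγ, lastHorFace_comp_conv _ _ hγ, LinearMap.comp_assoc, hface,
    phi_comp_convTpow _ hγ']
  congr 2
  funext i
  cases i using Fin.cases with
  | zero =>
    have hcancel : conv rho (antipodeComp (u ⊡ convProd n f)) (conv rho u (α 0)) =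
        conv rho (antipodeComp (convProd n f)) (α 0) := by
      rw [antipodeComp_convMul, ← conv_rho_conv_rho hma, conv_rho_conv_rho hma (antipodeComp u),
        hu.antipodeComp_convMul_self, conv_rho_convOne hma]
    have hlast : conv rho (antipodeComp (u ⊡ convProd n f)) (α (Fin.last (n + 1))) =
        conv rho (antipodeComp (convProd n f))
          (conv rho (antipodeComp u) (α (Fin.last (n + 1)))) := by
      rw [antipodeComp_convMul, conv_rho_conv_rho hma]
    simp only [Fin.cases_zero, convTailProd_zero, convTailProd_last, convProd_eq_mul_last n γ,
      hprod]
    simp only [α', Fin.cases_zero]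
    rw [hu.conv_rho_convMul hma, hu.conv_rho_antipodeComp_mul_cancel hma,
      hu.conv_rho_antipodeComp_mul_cancel hma,
      (hu.convMul hf).conv_rho_antipodeComp_convMul hma, conv_map_smul, hcancel, hlast]
    exact (conv_map_smul _ _ _ _).symm
  | succ i =>
    simp only [Fin.cases_succ, convTailProd_castSucc]
    refine (hu.conv_rho_antipodeComp_mul_cancel hma _ _).trans ?_
    rw [← convTailProd_succ_congr (f := f) (g := γ') fun _ => rfl]
    rfl

end Intertwining

section GenericElements

open Coalgebra

variable {k : Type} [Field k]
variable {C D : Type} [AddCommGroup C] [Module k C] [Coalgebra k C]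
  [AddCommGroup D] [Module k D] [Coalgebra k D]

/-- The projection of a tensor product of coalgebras to the first factor. -/
def coalgFst (k C D : Type) [Field k] [AddCommGroup C] [Module k C] [Coalgebra k C]
    [AddCommGroup D] [Module k D] [Coalgebra k D] : C ⊗[k] D →ₗc[k] C :=
  (Coalgebra.TensorProduct.rid k k C : C ⊗[k] k →ₗc[k] C).comp
    (Coalgebra.TensorProduct.map (.id k C) (counitCoalgHom k D))

/-- The projection of a tensor product of coalgebras to the second factor. -/
def coalgSnd (k C D : Type) [Field k] [AddCommGroup C] [Module k C] [Coalgebra k C]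
    [AddCommGroup D] [Module k D] [Coalgebra k D] : C ⊗[k] D →ₗc[k] D :=
  (Coalgebra.TensorProduct.lid k D : k ⊗[k] D →ₗc[k] D).comp
    (Coalgebra.TensorProduct.map (counitCoalgHom k C) (.id k D))

@[simp] lemma coalgFst_tmul (c : C) (d : D) : coalgFst k C D (c ⊗ₜ d) = counit (R := k) d • c := rfl

@[simp] lemma coalgSnd_tmul (c : C) (d : D) : coalgSnd k C D (c ⊗ₜ d) = counit (R := k) c • d := rfl

variable {V₁ V₂ V₃ : Type} [AddCommGroup V₁] [Module k V₁] [AddCommGroup V₂] [Module k V₂]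
  [AddCommGroup V₃] [Module k V₃]

lemma conv_fst_snd_tmul (m : V₁ →ₗ[k] V₂ →ₗ[k] V₃) (f : C →ₗ[k] V₁) (g : D →ₗ[k] V₂)
    (c : C) (d : D) :
    conv m (f ∘ₗ (coalgFst k C D : C ⊗[k] D →ₗ[k] C)) (g ∘ₗ (coalgSnd k C D : C ⊗[k] D →ₗ[k] D))
      (c ⊗ₜ d) = m (f c) (g d) := by
  have h (v : C ⊗[k] C) (w : D ⊗[k] D) :
      TensorProduct.lift m (TensorProduct.map
        (f ∘ₗ (coalgFst k C D : C ⊗[k] D →ₗ[k] C)) (g ∘ₗ (coalgSnd k C D : C ⊗[k] D →ₗ[k] D))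
          (TensorProduct.AlgebraTensorModule.tensorTensorTensorComm k k k k C C D D (v ⊗ₜ w))) =
        m (f (TensorProduct.rid k C (counit.lTensor C v)))
          (g (TensorProduct.lid k D (counit.rTensor D w))) := by
    induction v with
    | zero => simp
    | add x y hx hy =>
      simp only [TensorProduct.add_tmul, map_add, hx, hy, LinearMap.add_apply]
    | tmul c₁ c₂ =>
      induction w with
      | zero => simp
      | add x y hx hy => simp only [TensorProduct.tmul_add, map_add, hx, hy]
      | tmul d₁ d₂ =>
        simp [smul_smul, mul_comm]
  rw [conv_apply, TensorProduct.comul_tmul, h, lTensor_counit_comul, rTensor_counit_comul]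
  simp

variable {H : Type} [Ring H] [HopfAlgebra k H] [IsCocomm k H] {A : Type} [Ring A] [Algebra k A]

/-- Every elementary tensor in `(A ⊗ H)^{⊗(n+1)}` is a value of a convolution of coalgebra maps
to `H` and linear maps to `A` defined on a cocommutative coalgebra. -/
lemma exists_convTpow_eq_tpow (n : ℕ) (a : Fin (n + 1) → A) (g : Fin (n + 1) → H) :
    ∃ (C : Type) (_ : AddCommGroup C) (_ : Module k C) (_ : Coalgebra k C) (_ : IsCocomm k C)
      (γ : Fin (n + 1) → C →ₗ[k] H) (α : Fin (n + 1) → C →ₗ[k] A) (c : C),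
      (∀ i, IsCoalgMap (γ i)) ∧
      convTpow n (fun i => conv (TensorProduct.mk k A H) (α i) (γ i)) c =
        tpow k (A ⊗[k] H) n fun i => a i ⊗ₜ g i := by
  let α₀ (a : A) : H →ₗ[k] A := LinearMap.toSpanSingleton k A a ∘ₗ counit
  have h₀ (a : A) (h : H) : conv (TensorProduct.mk k A H) (α₀ a) LinearMap.id h = a ⊗ₜ h := by
    have hw (w : H ⊗[k] H) : TensorProduct.lift (TensorProduct.mk k A H)
        (TensorProduct.map (α₀ a) LinearMap.id w) =
          a ⊗ₜ TensorProduct.lid k H (counit.rTensor H w) := by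
      induction w with
      | zero => simp
      | add x y hx hy => simp only [map_add, hx, hy, TensorProduct.tmul_add]
      | tmul x y => simp [α₀, TensorProduct.smul_tmul]
    rw [conv_apply, hw, rTensor_counit_comul, TensorProduct.lid_tmul, one_smul]
  induction n with
  | zero => exact ⟨H, inferInstance, inferInstance, inferInstance, inferInstance,
      fun _ => LinearMap.id, fun _ => α₀ (a 0), g 0, fun _ => isCoalgMap_id, h₀ _ _⟩
  | succ n ih =>
    obtain ⟨C, _, _, _, _, γ, α, c, hγ, hc⟩ := ih (fun i => a i.succ) fun i => g i.succ
    refine ⟨H ⊗[k] C, inferInstance, inferInstance, inferInstance, inferInstance,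
      Fin.cases (coalgFst k H C : H ⊗[k] C →ₗ[k] H)
        fun i => γ i ∘ₗ (coalgSnd k H C : H ⊗[k] C →ₗ[k] C),
      Fin.cases (α₀ (a 0) ∘ₗ (coalgFst k H C : H ⊗[k] C →ₗ[k] H))
        fun i => α i ∘ₗ (coalgSnd k H C : H ⊗[k] C →ₗ[k] C),
      g 0 ⊗ₜ c, ?_, ?_⟩
    · intro i
      cases i using Fin.cases with
      | zero => exact isCoalgMap_id.comp (coalgFst k H C)
      | succ i => exact (hγ i).comp (coalgSnd k H C)
    · have h₁ := conv_comp (TensorProduct.mk k A H) (α₀ (a 0)) LinearMap.id (coalgFst k H C)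
      have h₂ := convTpow_comp n (fun i => conv (TensorProduct.mk k A H) (α i) (γ i))
        (coalgSnd k H C)
      simp only [conv_comp] at h₂
      rw [convTpow_succ, tpow_succ, ← h₀ (a 0), ← hc, ← conv_fst_snd_tmul (tcons k (A ⊗[k] H) n),
        h₁, h₂]
      rfl

end GenericElements

section Evaluation

open Coalgebra

section PiSums

variable {M : Type} [AddCommMonoid M]

lemma sum_piFinset_succ {n : ℕ} {ι : Fin (n + 1) → Type} (s : ∀ i, Finset (ι i))
    (F : (∀ i, ι i) → M) :
    ∑ e ∈ Fintype.piFinset s, F e =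
      ∑ b ∈ s 0, ∑ e ∈ Fintype.piFinset fun i : Fin n => s i.succ, F (Fin.cons b e) := by
  rw [← Finset.sum_product']
  refine Finset.sum_nbij' (fun e => (e 0, fun i => e i.succ)) (fun p => Fin.cons p.1 p.2)
    ?_ ?_ ?_ ?_ ?_
  · intro e he
    simp only [Fintype.mem_piFinset] at he
    simp [he]
  · rintro ⟨b, e⟩ h
    simp only [Finset.mem_product, Fintype.mem_piFinset] at h ⊢
    exact Fin.cases h.1 h.2
  · intro e _
    exact Fin.cons_self_tail e
  · rintro ⟨b, e⟩ _
    rfl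
  · intro e _
    exact congrArg F (Fin.cons_self_tail e).symm

lemma sum_piFinset_sigma {κ : Type} [Fintype κ] [DecidableEq κ] {ι : κ → Type}
    {J : ∀ i, ι i → Type} (s : ∀ i, Finset (ι i)) (t : ∀ i (b : ι i), Finset (J i b))
    (F : (∀ i, Σ b : ι i, J i b) → M) :
    ∑ e ∈ Fintype.piFinset fun i => (s i).sigma (t i), F e =
      ∑ e ∈ Fintype.piFinset s, ∑ f ∈ Fintype.piFinset fun i => t i (e i),
        F fun i => ⟨e i, f i⟩ := by
  rw [Finset.sum_sigma']
  refine Finset.sum_nbij' (fun e => ⟨fun i => (e i).1, fun i => (e i).2⟩)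
    (fun p i => ⟨p.1 i, p.2 i⟩) ?_ ?_ ?_ ?_ ?_
  · intro e he
    simp only [Fintype.mem_piFinset, Finset.mem_sigma] at he ⊢
    exact ⟨fun i => (he i).1, fun i => (he i).2⟩
  · rintro ⟨e, f⟩ h
    simp only [Fintype.mem_piFinset, Finset.mem_sigma] at h ⊢
    exact fun i => ⟨h.1 i, h.2 i⟩
  · intro e _
    rfl
  · rintro ⟨e, f⟩ _
    rfl
  · intro e _
    rfl

lemma ofFn_congr_length {X : Type} {m n : ℕ} (h : m = n) {f : Fin m → X} {g : Fin n → X}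
    (hfg : ∀ (c : ℕ) (hm : c < m) (hn : c < n), f ⟨c, hm⟩ = g ⟨c, hn⟩) :
    List.ofFn f = List.ofFn g := by
  subst h
  exact congrArg _ (funext fun c => hfg c c.2 c.2)

end PiSums

section SplitLast

variable {V : Type}

/-- The tuple obtained from `x` by replacing its last entry with the two entries `u, v`. -/
def splitLast : (n : ℕ) → (Fin (n + 1) → V) → V → V → Fin (n + 2) → V
  | 0, _, u, v => Fin.cases u fun _ => v
  | n + 1, x, u, v => Fin.cases (x 0) (splitLast n (fun i => x i.succ) u v)


lemma splitLast_of_lt (n : ℕ) (x : Fin (n + 1) → V) (u v : V) (c : ℕ) (hc : c < n) :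
    splitLast n x u v ⟨c, by omega⟩ = x ⟨c, by omega⟩ := by
  induction n generalizing c with
  | zero => omega
  | succ n ih =>
    cases c with
    | zero => rfl
    | succ c => exact ih (fun i => x i.succ) c (by omega)

lemma splitLast_penultimate (n : ℕ) (x : Fin (n + 1) → V) (u v : V) :
    splitLast n x u v ⟨n, by omega⟩ = u := by
  induction n with
  | zero => rfl
  | succ n ih => exact ih fun i => x i.succ

lemma splitLast_last (n : ℕ) (x : Fin (n + 1) → V) (u v : V) :
    splitLast n x u v (Fin.last (n + 1)) = v := by
  induction n with
  | zero => rfl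
  | succ n ih => exact ih fun i => x i.succ

variable {k : Type} [Field k] {H : Type} [Ring H] [HopfAlgebra k H]

lemma IterRepr.comul_eq {h : H} (R : IterRepr k H 1 h) :
    comul h = ∑ i ∈ R.s, R.leg i 0 ⊗ₜ[k] R.leg i 1 :=
  (LinearMap.congr_fun comulIter_one h).symm.trans R.eq.symm

/-- Comultiplying the last tensor factor. -/
def lastComul (k : Type) [Field k] (H : Type) [Ring H] [HopfAlgebra k H] :
    (n : ℕ) → Tpow k H n →ₗ[k] Tpow k H (n + 1)
  | 0 => (comul : H →ₗ[k] H ⊗[k] H)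
  | n + 1 => tlift ((tcons k H (n + 1)).compl₂ (lastComul k H n))

lemma lastComul_tpow (n : ℕ) (x : Fin (n + 1) → H) (R : IterRepr k H 1 (x (Fin.last n))) :
    lastComul k H n (tpow k H n x) =
      ∑ i ∈ R.s, tpow k H (n + 1) (splitLast n x (R.leg i 0) (R.leg i 1)) := by
  induction n with
  | zero => exact R.comul_eq
  | succ n ih =>
    rw [tpow_succ]
    simp only [lastComul, tlift_tcons, LinearMap.compl₂_apply, ih (fun i => x i.succ) R, map_sum]
    rfl

lemma lastComul_comp_comulIter (n : ℕ) :
    lastComul k H n ∘ₗ comulIter k H n = comulIter k H (n + 1) := by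
  induction n with
  | zero => exact comulIter_one.symm
  | succ n ih =>
    have h : lastComul k H (n + 1) = LinearMap.lTensor H (lastComul k H n) :=
      tcons_hom_ext fun _ _ => rfl
    have h' : LinearMap.lTensor H (comulIter k H (n + 1)) =
        LinearMap.lTensor H (lastComul k H n) ∘ₗ LinearMap.lTensor H (comulIter k H n) := by
      rw [← LinearMap.lTensor_comp, ih]
    rw [h]
    exact (congrArg (· ∘ₗ (comul : H →ₗ[k] H ⊗[k] H)) h').symm

/-- The refinement of a Sweedler representation obtained by comultiplying the last legs. -/
def IterRepr.splitLast {n : ℕ} {h : H} (R : IterRepr k H n h)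
    (S : ∀ i, IterRepr k H 1 (R.leg i (Fin.last n))) : IterRepr k H (n + 1) h where
  ι := Σ i, (S i).ι
  s := R.s.sigma fun i => (S i).s
  leg p := _root_.splitLast n (R.leg p.1) ((S p.1).leg p.2 0) ((S p.1).leg p.2 1)
  eq := by
    rw [Finset.sum_sigma, ← lastComul_comp_comulIter, LinearMap.comp_apply, ← R.eq, map_sum]
    exact Finset.sum_congr rfl fun i _ => (lastComul_tpow n _ (S i)).symm

end SplitLast

end Evaluation

section Characterization

open Coalgebra

variable {k : Type} [Field k] {H : Type} [Ring H] [HopfAlgebra k H]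
variable {A : Type} [Ring A] [Algebra k A] {rho : H →ₗ[k] A →ₗ[k] A} {sg : H →ₗ[k] H →ₗ[k] k}

lemma splitProd_tpow (n : ℕ) (g : Fin (n + 1) → H) (R : ∀ i, IterRepr k H 1 (g i)) :
    splitProd k H n (tpow k H n g) =
      ∑ e ∈ Fintype.piFinset fun i => (R i).s,
        (List.ofFn fun i => (R i).leg (e i) 0).prod ⊗ₜ[k]
          tpow k H n fun i => (R i).leg (e i) 1 := by
  induction n with
  | zero =>
    rw [sum_piFinset_succ]
    refine (R 0).comul_eq.trans (Finset.sum_congr rfl fun b _ => ?_)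
    simp [tpow]
    rfl
  | succ n ih =>
    rw [sum_piFinset_succ, tpow_succ]
    simp only [splitProd, tlift_tcons, LinearMap.compl₁₂_apply, (R 0).comul_eq,
      ih _ fun i => R i.succ, map_sum, LinearMap.sum_apply, zipCompose_tmul]
    rw [Finset.sum_comm]
    refine Finset.sum_congr rfl fun b _ => Finset.sum_congr rfl fun e _ => ?_
    let e' : ∀ i, (R i).ι := Fin.cons b e
    have h : (List.ofFn fun i => (R i).leg (e' i) 0).prod =
        (R 0).leg b 0 * (List.ofFn fun i => (R i.succ).leg (e i) 0).prod :=
      (congrArg List.prod List.ofFn_succ).trans List.prod_cons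
    exact congrArg (· ⊗ₜ[k] _) h.symm

lemma lastVerFace_tpow (m n : ℕ) (g : Fin (m + 1) → H) (a : Fin (n + 2) → A)
    (R : ∀ i, IterRepr k H 1 (g i)) :
    lastVerFace rho m n (tpow k H m g ⊗ₜ tpow k A (n + 1) a) =
      ∑ e ∈ Fintype.piFinset (fun i => (R i).s),
        tpow k H m (fun i => (R i).leg (e i) 1) ⊗ₜ[k]
        tpow k A n
          (Fin.cases
            (rho (HopfAlgebra.antipode (R := k)
                ((List.ofFn (fun i : Fin (m + 1) => (R i).leg (e i) 0)).prod))
              (a (Fin.last (n + 1))) * a 0)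
            (fun c : Fin n => a c.succ.castSucc)) := by
  simp only [lastVerFace, TensorProduct.lift.tmul, LinearMap.compl₁₂_apply,
    splitProd_tpow m g R, unsnoc_tpow, map_sum, LinearMap.sum_apply, actComposeSwap_tmul,
    headCompose_tmul, headAct_tpow]
  rfl

lemma tpow_tmul_hom_ext {V W X : Type} [AddCommGroup V] [Module k V] [AddCommGroup W] [Module k W]
    [AddCommGroup X] [Module k X] {m n : ℕ} {f g : Tpow k V m ⊗[k] Tpow k W n →ₗ[k] X}
    (h : ∀ x y, f (tpow k V m x ⊗ₜ tpow k W n y) = g (tpow k V m x ⊗ₜ tpow k W n y)) : f = g :=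
  TensorProduct.curry_injective <| tpow_hom_ext fun x => tpow_hom_ext fun y => h x y

lemma IsLastVerFace.eq_lastVerFace {m n : ℕ}
    {D : Tpow k H m ⊗[k] Tpow k A (n + 1) →ₗ[k] Tpow k H m ⊗[k] Tpow k A n}
    (hD : IsLastVerFace k H A rho m n D) : D = lastVerFace rho m n :=
  tpow_tmul_hom_ext fun g a => by
    have R (i : Fin (m + 1)) := (exists_iterRepr (k := k) 1 (g i)).some
    exact (hD g a R).trans (lastVerFace_tpow m n g a R).symm

lemma diagAct_tpow (n : ℕ) (x : Fin (n + 3) → H) (a : Fin (n + 1) → A) :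
    diagAct rho n (tpow k H (n + 2) x) (tpow k A n a) =
      tpow k A n (fun i => rho (x (Fin.castLE (by omega) i)) (a i)) ⊗ₜ
        (x ⟨n + 1, by omega⟩ ⊗ₜ[k] x ⟨n + 2, by omega⟩) := by
  induction n with
  | zero => rfl
  | succ n ih =>
    exact (zipCompose_tmul _ rho (diagAct rho n) (x 0) (tpow k H (n + 2) fun i => x i.succ) (a 0)
      (tpow k A n fun i => a i.succ)).trans (congrArg _ (ih _ _))

lemma lastHorFace_tpow (n q : ℕ) (g : Fin (n + 2) → H) (a : Fin (q + 1) → A)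
    (R : IterRepr k H (q + 2) (g (Fin.last (n + 1)))) (S : IterRepr k H 1 (g 0)) :
    lastHorFace rho sg n q (tpow k H (n + 1) g ⊗ₜ tpow k A q a) =
      ∑ r ∈ R.s, ∑ s ∈ S.s,
        tpow k H n
          (Fin.cases (R.leg r ⟨q + 1, by omega⟩ * S.leg s 0)
            (fun j : Fin n => g j.succ.castSucc)) ⊗ₜ[k]
        tpow k A q (fun c : Fin (q + 1) =>
          if c = 0 then
            sg (R.leg r ⟨q + 2, by omega⟩) (S.leg s 1) • rho (R.leg r 0) (a 0)
          else rho (R.leg r (Fin.castLE (by omega) c)) (a c)) := by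
  have hS : headSplit ((TensorProduct.comm k H H).toLinearMap ∘ₗ comul) n
      (tpow k H n fun i => g i.castSucc) =
        ∑ s ∈ S.s, S.leg s 1 ⊗ₜ tpow k H n (Fin.cases (S.leg s 0) fun j => g j.succ.castSucc) :=
    headSplit_tpow (by simp [S.comul_eq])
  simp only [lastHorFace, TensorProduct.lift.tmul, LinearMap.comp_apply, unsnoc_tpow,
    actComposeSwap_tmul, ← R.eq, map_sum, LinearMap.sum_apply, diagAct_tpow, horFaceMerge, hS,
    tailCompose_tmul, headCompose_tmul, LinearMap.flip_apply, headAct_tpow, TensorProduct.mk_apply]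
  refine Finset.sum_congr rfl fun r _ => Finset.sum_congr rfl fun s _ => ?_
  congr 2
  ext c
  cases c using Fin.cases with
  | zero => rfl
  | succ c => rfl

lemma IsLastHorFace.eq_lastHorFace {n q : ℕ}
    {D : Tpow k H (n + 1) ⊗[k] Tpow k A q →ₗ[k] Tpow k H n ⊗[k] Tpow k A q}
    (hD : IsLastHorFace k H A rho sg n q D) : D = lastHorFace rho sg n q :=
  tpow_tmul_hom_ext fun g a => by
    obtain ⟨R⟩ := exists_iterRepr (k := k) (q + 2) (g (Fin.last (n + 1)))
    obtain ⟨S⟩ := exists_iterRepr (k := k) 1 (g 0)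
    exact (hD g a R S).trans (lastHorFace_tpow n q g a R S).symm

lemma crossedMul_tmul (a b : A) (h l : H) (R : IterRepr k H 2 h) (S : IterRepr k H 1 l) :
    crossedMul rho sg (a ⊗ₜ h) (b ⊗ₜ l) =
      ∑ i ∈ R.s, ∑ j ∈ S.s,
        (sg (R.leg i 1) (S.leg j 0) • (a * rho (R.leg i 0) b)) ⊗ₜ[k]
          (R.leg i 2 * S.leg j 1) := by
  let N : H ⊗[k] (H ⊗[k] H) →ₗ[k] A ⊗[k] H →ₗ[k] A ⊗[k] H := actComposeSwap
      (tailCompose (headCompose (TensorProduct.mk k A H) (LinearMap.lsmul k A).flip)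
        ((zipCompose (TensorProduct.mk k k H) sg (LinearMap.mul k H)).compl₂ comul))
      (headCompose (TensorProduct.mk k A H) rho)
  have hN (w : H ⊗[k] H) (z : A ⊗[k] H) : actComposeSwap
      (tailCompose (headCompose (TensorProduct.mk k A H) (LinearMap.lsmul k A).flip)
        ((zipCompose (TensorProduct.mk k k H) sg (LinearMap.mul k H)).compl₁₂ comul comul))
      (headCompose (TensorProduct.mk k A H) rho) w z = N (comul.lTensor H w) z := by
    induction w with
    | zero => simp
    | add x y hx hy => simp only [map_add, LinearMap.add_apply, hx, hy]
    | tmul x y =>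
      induction z with
      | zero => simp
      | add u v hu hv => simp only [map_add, hu, hv]
      | tmul b h => simp [N]
  have hR : (comul.lTensor H (comul (R := k) h) : H ⊗[k] (H ⊗[k] H)) =
      ∑ i ∈ R.s, R.leg i 0 ⊗ₜ (R.leg i 1 ⊗ₜ R.leg i 2) := by
    refine Eq.trans ?_ R.eq.symm
    exact congrArg (fun f : H →ₗ[k] H ⊗[k] H => f.lTensor H (comul (R := k) h)) comulIter_one.symm
  rw [crossedMul, actCompose_tmul, LinearMap.comp_apply, hN, hR]
  simp only [N, map_sum, LinearMap.sum_apply, actComposeSwap_tmul, headCompose_tmul,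
    tailCompose_tmul, TensorProduct.mk_apply, LinearMap.compl₂_apply, S.comul_eq, zipCompose_tmul,
    LinearMap.flip_apply, LinearMap.lsmul_apply, LinearMap.mul_apply', mul_smul_comm]

lemma IsCrossedMul.eq_crossedMul {mul : A ⊗[k] H →ₗ[k] A ⊗[k] H →ₗ[k] A ⊗[k] H}
    (hmul : IsCrossedMul k H A rho sg mul) : mul = crossedMul rho sg := by
  refine TensorProduct.ext' fun a h => TensorProduct.ext' fun b l => ?_
  obtain ⟨R⟩ := exists_iterRepr (k := k) 2 h
  obtain ⟨S⟩ := exists_iterRepr (k := k) 1 l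
  exact (hmul a b h l R S).trans (crossedMul_tmul a b h l R S).symm

lemma IsAlgLastFace.eq_algLastFace {mul : A ⊗[k] H →ₗ[k] A ⊗[k] H →ₗ[k] A ⊗[k] H} {n : ℕ}
    {D : Tpow k (A ⊗[k] H) (n + 1) →ₗ[k] Tpow k (A ⊗[k] H) n}
    (hD : IsAlgLastFace k H A mul n D) : D = algLastFace mul n :=
  tpow_hom_ext fun x => by
    rw [hD x, algLastFace, LinearMap.comp_apply, unsnoc_tpow, TensorProduct.lift.tmul,
      headAct_tpow]
    rfl

/-- The right-hand side of `IsPhi`. -/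
def phiSum (rho : H →ₗ[k] A →ₗ[k] A) (n : ℕ) (a : Fin (n + 1) → A) (g : Fin (n + 1) → H)
    (R : ∀ i : Fin (n + 1), IterRepr k H ((i : ℕ) + 1) (g i)) :
    Tpow k H n ⊗[k] Tpow k A n :=
  ∑ e ∈ Fintype.piFinset (fun i => (R i).s),
    tpow k H n (fun i => (R i).leg (e i) (Fin.last ((i : ℕ) + 1))) ⊗ₜ[k]
    tpow k A n (fun i =>
      rho (HopfAlgebra.antipode (R := k)
          ((List.ofFn (fun m : Fin (n + 1 - (i : ℕ)) =>
            (R ⟨(i : ℕ) + (m : ℕ), by have := m.isLt; have := i.isLt; omega⟩).leg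
              (e ⟨(i : ℕ) + (m : ℕ), by have := m.isLt; have := i.isLt; omega⟩)
              ⟨(m : ℕ), by have := m.isLt; have := i.isLt; simp; omega⟩)).prod))
        (a i))

lemma exists_phiSum_eq (n : ℕ) (a : Fin (n + 1) → A) (g : Fin (n + 1) → H) :
    ∃ R, phiSum rho n a g R = phi rho n (tpow k (A ⊗[k] H) n fun i => a i ⊗ₜ g i) := by
  induction n with
  | zero =>
    obtain ⟨R⟩ := exists_iterRepr (k := k) 1 (g 0)
    refine ⟨Fin.cases R fun i => i.elim0, ?_⟩
    rw [phiSum, sum_piFinset_succ]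
    have h : phi rho 0 (tpow k (A ⊗[k] H) 0 fun i => a i ⊗ₜ g i) =
        actComposeSwap (TensorProduct.mk k H A) (antipodeAct rho) (comul (g 0)) (a 0) := rfl
    rw [h, R.comul_eq, map_sum, LinearMap.sum_apply]
    refine Finset.sum_congr rfl fun b _ => ?_
    simp [tpow, antipodeAct]
    rfl
  | succ n ih =>
    obtain ⟨R', hR'⟩ := ih (fun i => a i.succ) fun i => g i.succ
    obtain ⟨R₀⟩ := exists_iterRepr (k := k) 1 (g 0)
    have S (i : Fin (n + 1)) (j) :=
      (exists_iterRepr (k := k) 1 ((R' i).leg j (Fin.last _))).some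
    let R : ∀ i : Fin (n + 2), IterRepr k H ((i : ℕ) + 1) (g i) :=
      Fin.cases R₀ fun i => (R' i).splitLast (S i)
    refine ⟨R, ?_⟩
    rw [phiSum, sum_piFinset_succ]
    refine (Finset.sum_congr rfl fun b _ => sum_piFinset_sigma _ _ _).trans ?_
    rw [tpow_succ]
    simp only [phi, tlift_tcons, LinearMap.compl₂_apply, LinearMap.comp_apply]
    rw [← hR', phiSum, map_sum]
    rw [Finset.sum_comm]
    refine Finset.sum_congr rfl fun e' _ => ?_
    refine Eq.trans ?_ (zipCompose_tmul _ _ _ _ _ _ _).symm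
    have hsplit := splitProd_tpow (n + 1)
      (Fin.cases (g 0) fun i => (R' i).leg (e' i) (Fin.last _))
      (Fin.cases R₀ fun i => S i (e' i))
    rw [tpow_cons] at hsplit
    rw [LinearMap.comp_apply, hsplit, sum_piFinset_succ]
    simp only [map_sum, LinearMap.sum_apply]
    refine Finset.sum_congr rfl fun b _ => Finset.sum_congr rfl fun f _ => ?_
    refine Eq.trans ?_ (actComposeSwap_tmul _ _ _ _ _).symm
    let e : ∀ i, (R i).ι := Fin.cons b fun i => ⟨e' i, f i⟩
    have hleg (j : Fin (n + 2)) (j' : Fin (n + 1)) (hj : j = j'.succ) (c : ℕ)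
        (hc : c < (j : ℕ) + 1 + 1) (hc' : c < (j' : ℕ) + 1) :
        (R j).leg (e j) ⟨c, hc⟩ = (R' j').leg (e' j') ⟨c, by omega⟩ := by
      subst hj
      exact splitLast_of_lt _ _ _ _ c hc'
    have hmid (j : Fin (n + 2)) (j' : Fin (n + 1)) (hj : j = j'.succ) (c : ℕ)
        (hc : c < (j : ℕ) + 1 + 1) (hc' : c = (j' : ℕ) + 1) :
        (R j).leg (e j) ⟨c, hc⟩ = (S j' (e' j')).leg (f j') 0 := by
      subst hj hc'
      exact splitLast_penultimate _ _ _ _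
    refine congrArg₂ (· ⊗ₜ[k] ·) (congrArg (tpow k H (n + 1)) (funext fun i => ?_))
      (congrArg₂ (fun u v => tcons k A n u v) ?_ (congrArg (tpow k A n) (funext fun i => ?_)))
    · cases i using Fin.cases with
      | zero => rfl
      | succ i => exact splitLast_last _ _ _ _
    · refine congrArg (fun w => rho (HopfAlgebra.antipode k w) (a 0))
        (congrArg List.prod (ofFn_congr_length rfl fun c hm hn => ?_))
      cases c with
      | zero => rfl
      | succ c =>
        exact hmid _ ⟨c, by omega⟩ (Fin.ext (Nat.zero_add _)) (c + 1) _ rfl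
    · refine congrArg (fun w => rho (HopfAlgebra.antipode k w) (a i.succ))
        (congrArg List.prod (ofFn_congr_length (by simp) fun c hm hn => ?_))
      refine hleg _ _ (Fin.ext ?_) c _ ?_
      · exact Nat.add_right_comm _ _ _
      · simp

lemma tpow_tensor_hom_ext {V W X : Type} [AddCommGroup V] [Module k V] [AddCommGroup W]
    [Module k W] [AddCommGroup X] [Module k X] {n : ℕ} {f g : Tpow k (V ⊗[k] W) n →ₗ[k] X}
    (h : ∀ (x : Fin (n + 1) → V) (y : Fin (n + 1) → W),
      f (tpow k (V ⊗[k] W) n fun i => x i ⊗ₜ y i) =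
      g (tpow k (V ⊗[k] W) n fun i => x i ⊗ₜ y i)) : f = g := by
  induction n generalizing X with
  | zero => exact TensorProduct.ext' fun v w => h (fun _ => v) fun _ => w
  | succ n ih =>
    have key : TensorProduct.curry (R := k) (M := V ⊗[k] W) (N := Tpow k (V ⊗[k] W) n) f =
        TensorProduct.curry (R := k) (M := V ⊗[k] W) (N := Tpow k (V ⊗[k] W) n) g :=
      TensorProduct.ext' fun v w => ih fun x y => by
        exact h (Fin.cases (motive := fun _ => V) v x) (Fin.cases (motive := fun _ => W) w y)
    exact TensorProduct.curry_injective key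

lemma IsPhi.eq_phi {n : ℕ} {Phi : Tpow k (A ⊗[k] H) n →ₗ[k] Tpow k H n ⊗[k] Tpow k A n}
    (hPhi : IsPhi k H A rho n Phi) : Phi = phi rho n :=
  tpow_tensor_hom_ext fun a g => by
    obtain ⟨R, hR⟩ := exists_phiSum_eq (rho := rho) n a g
    exact (hPhi a g R).trans hR

end Characterization

/-- Under the standing assumptions (here with `N = n + 1 ≥ 1`), `Φ`
intertwines the last face of the cyclic module of `A #_σ H` with the diagonal last face
`d_N ∘ δ_N`:  `(d_N ∘ δ_N) ∘ Φ = Φ ∘ δ_N^{A#_σH}`. -/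
theorem phi_intertwines_last_face
    (k : Type) [Field k] (H : Type) [Ring H] [HopfAlgebra k H]
    (A : Type) [Ring A] [Algebra k A]
    (rho : H →ₗ[k] A →ₗ[k] A) (sg : H →ₗ[k] H →ₗ[k] k)
    (hco : Cocomm k H) (hma : IsModuleAlgebraAction k H A rho)
    (hnorm : NormalKA k H A sg) (hcoc : CocycleKA k H A sg)
    (htw : TwistedModuleK k H A rho sg) (hinv : ConvInvertibleK k H A sg)
    (n : ℕ)
    (mul : (A ⊗[k] H) →ₗ[k] (A ⊗[k] H) →ₗ[k] (A ⊗[k] H))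
    (hmul : IsCrossedMul k H A rho sg mul)
    (PhiBig : (Tpow k (A ⊗[k] H) (n + 1) : Type) →ₗ[k]
      ((Tpow k H (n + 1) : Type) ⊗[k] (Tpow k A (n + 1) : Type)))
    (PhiSmall : (Tpow k (A ⊗[k] H) n : Type) →ₗ[k]
      ((Tpow k H n : Type) ⊗[k] (Tpow k A n : Type)))
    (Falg : (Tpow k (A ⊗[k] H) (n + 1) : Type) →ₗ[k] (Tpow k (A ⊗[k] H) n : Type))
    (DverLast : ((Tpow k H (n + 1) : Type) ⊗[k] (Tpow k A (n + 1) : Type)) →ₗ[k]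
      ((Tpow k H (n + 1) : Type) ⊗[k] (Tpow k A n : Type)))
    (DhorLast : ((Tpow k H (n + 1) : Type) ⊗[k] (Tpow k A n : Type)) →ₗ[k]
      ((Tpow k H n : Type) ⊗[k] (Tpow k A n : Type)))
    (hPhiBig : IsPhi k H A rho (n + 1) PhiBig)
    (hPhiSmall : IsPhi k H A rho n PhiSmall)
    (hFalg : IsAlgLastFace k H A mul n Falg)
    (hDverLast : IsLastVerFace k H A rho (n + 1) n DverLast)
    (hDhorLast : IsLastHorFace k H A rho sg n n DhorLast) :
    (DhorLast ∘ₗ DverLast) ∘ₗ PhiBig = PhiSmall ∘ₗ Falg := by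
  have : Coalgebra.IsCocomm k H := ⟨LinearMap.ext hco⟩
  rw [hPhiBig.eq_phi, hPhiSmall.eq_phi, hFalg.eq_algLastFace, hmul.eq_crossedMul,
    hDverLast.eq_lastVerFace, hDhorLast.eq_lastHorFace]
  refine tpow_tensor_hom_ext fun a g => ?_
  obtain ⟨C, _, _, _, _, γ, α, c, hγ, hc⟩ := exists_convTpow_eq_tpow (k := k) (n + 1) a g
  rw [← hc]
  exact LinearMap.congr_fun (phi_intertwines_on_convTpow hma n hγ α) c
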